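/- arXiv:2104.05664 — 2 statements merged into one kernel-verified Lean document; each statement's English description precedes it below -/
import Mathlib

section
/- Let (p, q, r) be positive integers with 1/p + 1/q + 1/r < 1 and a, b, c nonzero integers. Let S be the quasi-projective surface obtained from the affine surface {(x, y, z) ∈ 𝔸³ : a·x^p + b·y^q = c·z^r} by removing the origin, and let β : S → ℙ¹ be the morphism β(x, y, z) = a·x^p/(c·z^r). Let π : C → ℙ¹ be a finite cover by a smooth projective curve, ramified precisely over {0, 1, ∞}, with ramification order p at every point above 0, q at every point above 1, and r at every point above ∞. Let F be the normalization of the fiber product S ×_{ℙ¹} C and π̄ : F → S the induced finite dominant map. Then the induced map π̄_ℂ : F(ℂ) → S(ℂ) on complex points (Euclidean topology) is an unramified topological cover. -/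
/- STATEMENT 8 (Proposition of Darmon–Granville type).  The base `ℙ¹(ℂ)` is modelled as
the Riemann sphere `OnePoint ℂ`; the curve `C` is a topological model of the smooth
projective curve (a compact connected Hausdorff space), the cover `π : C → ℙ¹` being
continuous, a covering map away from `{0, 1, ∞}`, and locally of the form `z ↦ z^e`
(with `e = p, q, r` respectively) at the points above `0, 1, ∞`.  The normalization `F`
of the fiber product `S ×_{ℙ¹} C` is axiomatized by the topological properties that
characterize it: a finite proper surjection onto the fiber product which is a
homeomorphism over the locus where `β ∉ {0, 1, ∞}`, with that locus dense upstairs and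
with connected local branches (normality). -/

noncomputable section
namespace DarmonGranville

/-- The quasi-projective surface `S`: the affine surface `a·x^p + b·y^q = c·z^r` in
`𝔸³` minus the origin, with the Euclidean topology. -/
def FermatSurface (a b c : ℤ) (p q r : ℕ) : Set (ℂ × ℂ × ℂ) :=
  {v | (a : ℂ) * v.1 ^ p + (b : ℂ) * v.2.1 ^ q = (c : ℂ) * v.2.2 ^ r ∧ v ≠ 0}

/-- The map `β : S → ℙ¹`, `β(x, y, z) = a·x^p/(c·z^r)`, with value `∞` where the
denominator vanishes. -/
def beta (a c : ℤ) (p r : ℕ) (v : ℂ × ℂ × ℂ) : OnePoint ℂ :=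
  if (c : ℂ) * v.2.2 ^ r = 0 then OnePoint.infty
  else ((a : ℂ) * v.1 ^ p / ((c : ℂ) * v.2.2 ^ r) : ℂ)

/-- `f` has, around `γ` (lying over `x₀`), the local model `z ↦ z^e` of a ramification
point of order `e`: suitable charts of neighbourhoods of `γ` and `x₀` onto the unit disk,
centering `γ` and `x₀` at `0`, conjugate `f` into `z ↦ z^e`. -/
def HasLocalPowerModel {C : Type*} [TopologicalSpace C] (f : C → OnePoint ℂ)
    (γ : C) (x₀ : OnePoint ℂ) (e : ℕ) : Prop :=
  ∃ (U : Set C) (V : Set (OnePoint ℂ)) (_ : IsOpen U) (hγ : γ ∈ U) (_ : IsOpen V)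
    (hx : x₀ ∈ V) (hf : ∀ u ∈ U, f u ∈ V)
    (φ : U ≃ₜ Metric.ball (0 : ℂ) 1) (ψ : V ≃ₜ Metric.ball (0 : ℂ) 1),
      (φ ⟨γ, hγ⟩ : ℂ) = 0 ∧ (ψ ⟨x₀, hx⟩ : ℂ) = 0 ∧
      ∀ u : U, (ψ ⟨f u, hf u u.2⟩ : ℂ) = (φ u : ℂ) ^ e

/-- The three special points `0, 1, ∞` of `ℙ¹(ℂ)`. -/
def badSet : Set (OnePoint ℂ) :=
  {((0 : ℂ) : OnePoint ℂ), ((1 : ℂ) : OnePoint ℂ), OnePoint.infty}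

/-- The fiber product `S ×_{ℙ¹} C` of `β : S → ℙ¹` and `π : C → ℙ¹` (complex points,
Euclidean topology). -/
def fiberProd (a b c : ℤ) (p q r : ℕ) {C : Type} (π : C → OnePoint ℂ) :
    Set (FermatSurface a b c p q r × C) :=
  {w | beta a c p r (w.1 : ℂ × ℂ × ℂ) = π w.2}

/-- The locus of the fiber product lying over `ℙ¹ ∖ {0, 1, ∞}`, where the fiber product
is already smooth and maps to `S` as a covering. -/
def goodLocus (a b c : ℤ) (p q r : ℕ) {C : Type} (π : C → OnePoint ℂ) :
    Set (fiberProd a b c p q r π) :=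
  {w | π (w : FermatSurface a b c p q r × C).2 ∈ badSetᶜ}

section Helpers
open Set Filter Topology

theorem evenly_covered_of_sections {X F C B : Type*} [TopologicalSpace X] [TopologicalSpace F]
    [TopologicalSpace C] [T2Space X] [T2Space F] [T2Space C]
    (P : F → X) (k : F → C) (β : X → B) (π : C → B) (G : Set X)
    (hP : IsProperMap P) (hk : Continuous k)
    (hPfin : ∀ x, (P ⁻¹' {x}).Finite)
    (hβ : ∀ f, β (P f) = π (k f))
    (hinj : ∀ f f', P f ∈ G → P f = P f' → k f = k f' → f = f')
    (hsurj : ∀ x γ, β x = π γ → ∃ f, P f = x ∧ k f = γ)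
    (hbranch : ∀ x : F, ∀ W ∈ 𝓝 x, ∃ U ⊆ W, IsOpen U ∧ x ∈ U ∧ IsConnected (U ∩ P ⁻¹' G))
    (hbase : ∀ x : X, ∀ W ∈ 𝓝 x, ∃ U ⊆ W, IsOpen U ∧ x ∈ U ∧ IsConnected (U ∩ G))
    (x₀ : X) (N : Set X) (hN : IsOpen N) (hx₀ : x₀ ∈ N)
    (I : Type*) [Finite I] (L : I → X → C) (hL : ∀ i, ContinuousOn (L i) N)
    (hLβ : ∀ i, ∀ x ∈ N, β x = π (L i x))
    (hLu : ∀ x ∈ N, x ∈ G → ∀ γ, π γ = β x → ∃! i, L i x = γ) :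
    IsEvenlyCovered P x₀ (P ⁻¹' {x₀}) := by
  classical
  let : TopologicalSpace I := ⊥
  have : DiscreteTopology I := ⟨rfl⟩
  have hPc := hP.continuous
  have hO : IsOpen (P ⁻¹' N) := hN.preimage hPc
  -- the index predicate
  let Q : F → I → Prop := fun f i => ∃ U : Set F, IsOpen U ∧ f ∈ U ∧ U ⊆ P ⁻¹' N ∧
    ∀ f' ∈ U, P f' ∈ G → k f' = L i (P f')
  have hex : ∀ f, P f ∈ N → ∃ i, Q f i := by
    intro f hf
    obtain ⟨U, hUW, hUo, hfU, hUc⟩ := hbranch f (P ⁻¹' N) (hO.mem_nhds hf)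
    have key : ∀ v : ↥(U ∩ P ⁻¹' G), ∃! i, L i (P v) = k v := fun v =>
      hLu _ (hUW v.2.1) v.2.2 _ (hβ v).symm
    choose j hj hju using key
    have hjc : Continuous j := by
      rw [continuous_iff_isClosed]
      intro s _
      have : j ⁻¹' s = ⋃ i ∈ s, {v : ↥(U ∩ P ⁻¹' G) | L i (P v) = k v} := by
        ext v
        simp only [mem_preimage, mem_iUnion, mem_ofPred_eq, exists_prop]
        constructor
        · intro h; exact ⟨_, h, hj v⟩
        · rintro ⟨i, hi, h⟩
          rw [← hju v i h]; exact hi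
      rw [this]
      refine (toFinite s).isClosed_biUnion fun i _ => isClosed_eq ?_ (hk.comp continuous_subtype_val)
      exact (hL i).comp_continuous (hPc.comp continuous_subtype_val) fun v => hUW v.2.1
    have : PreconnectedSpace ↥(U ∩ P ⁻¹' G) :=
      isPreconnected_iff_preconnectedSpace.1 hUc.isPreconnected
    obtain ⟨v₀, hv₀⟩ := hUc.nonempty
    refine ⟨j ⟨v₀, hv₀⟩, U, hUo, hfU, hUW, fun f' hf' hG => ?_⟩
    have := PreconnectedSpace.constant (Y := I) inferInstance hjc
      (x := ⟨v₀, hv₀⟩) (y := ⟨f', hf', hG⟩)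
    rw [this]
    exact (hj ⟨f', hf', hG⟩).symm
  have huniq : ∀ f i i', Q f i → Q f i' → i = i' := by
    rintro f i i' ⟨U, hUo, hfU, hUN, hU⟩ ⟨U', hUo', hfU', hUN', hU'⟩
    obtain ⟨W, hW, -, -, ⟨v, hvW, hvG⟩, -⟩ :=
      hbranch f (U ∩ U') ((hUo.inter hUo').mem_nhds ⟨hfU, hfU'⟩)
    have hv := hW hvW
    exact (hLu _ (hUN hv.1) hvG _ (hβ v).symm).unique (hU _ hv.1 hvG).symm (hU' _ hv.2 hvG).symm
  have hQeq : ∀ f i, Q f i → k f = L i (P f) := by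
    rintro f i ⟨U, hUo, hfU, hUN, hU⟩
    refine tendsto_nhds_unique_of_frequently_eq (l := 𝓝 f) (f := k) (g := fun f => L i (P f))
      hk.continuousAt ?_ ?_
    · exact ((hL i).continuousAt (hN.mem_nhds (hUN hfU))).comp hPc.continuousAt
    · rw [frequently_iff]
      intro V hV
      obtain ⟨W, hW, -, -, ⟨v, hvW, hvG⟩, -⟩ :=
        hbranch f (U ∩ V) (inter_mem (hUo.mem_nhds hfU) hV)
      exact ⟨v, (hW hvW).2, hU _ (hW hvW).1 hvG⟩
  have hQgood : ∀ f i, P f ∈ N → P f ∈ G → k f = L i (P f) → Q f i := by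
    intro f i hf hG h
    obtain ⟨i', hi'⟩ := hex f hf
    have := (hLu _ hf hG _ (hβ f).symm).unique h.symm (hQeq _ _ hi').symm
    rwa [this]
  have hQclos : ∀ f i, P f ∈ N → f ∈ closure {f' | P f' ∈ N ∧ P f' ∈ G ∧ k f' = L i (P f')} →
      Q f i := by
    intro f i hf hcl
    obtain ⟨i', hi'⟩ := hex f hf
    obtain ⟨U, hUo, hfU, hUN, hU⟩ := id hi'
    obtain ⟨v, hvU, hvN, hvG, hv⟩ := mem_closure_iff.1 hcl U hUo hfU
    have := (hLu _ hvN hvG _ (hβ v).symm).unique hv.symm (hU v hvU hvG).symm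
    rwa [this]
  have hQsurj : ∀ x i, x ∈ N → ∃ f, P f = x ∧ Q f i := by
    intro x i hx
    have hcl := hP.isClosedMap _
      (isClosed_closure (s := {f' | P f' ∈ N ∧ P f' ∈ G ∧ k f' = L i (P f')}))
    have : x ∈ P '' closure {f' | P f' ∈ N ∧ P f' ∈ G ∧ k f' = L i (P f')} := by
      rw [← hcl.closure_eq, mem_closure_iff]
      intro V hV hxV
      obtain ⟨W, hW, -, -, ⟨v, hvW, hvG⟩, -⟩ := hbase x (N ∩ V) ((hN.inter hV).mem_nhds ⟨hx, hxV⟩)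
      obtain ⟨f, hf, hkf⟩ := hsurj v (L i v) (hLβ i v (hW hvW).1)
      refine ⟨v, (hW hvW).2, f, subset_closure ?_, hf⟩
      subst hf
      exact ⟨(hW hvW).1, hvG, hkf⟩
    obtain ⟨f, hf, rfl⟩ := this
    exact ⟨f, rfl, hQclos f i hx hf⟩
  have hQinj : ∀ f f' i, P f ∈ N → P f = P f' → Q f i → Q f' i → f = f' := by
    intro f f' i hf hff' hQ hQ'
    by_contra hne
    have hsep : SeparatedNhds ({f} : Set F) (P ⁻¹' {P f} \ {f}) :=
      SeparatedNhds.of_isCompact_isCompact isCompact_singleton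
        ((hPfin (P f)).subset sdiff_subset).isCompact (by simp)
    obtain ⟨W₁, W₂, hW₁, hW₂, h₁, h₂, hd⟩ := hsep
    have hnb : {x | ∀ g, P g = x → g ∈ W₁ ∪ W₂} ∈ 𝓝 (P f) := by
      have hc := hP.isClosedMap _ (hW₁.union hW₂).isClosed_compl
      filter_upwards [hc.isOpen_compl.mem_nhds (x := P f) (by
        rintro ⟨g, hg, hgf⟩
        apply hg
        by_cases h : g = f
        · left; exact h₁ h
        · right; exact h₂ ⟨hgf, h⟩)] with x hx g hg
      by_contra hgW
      exact hx ⟨g, hgW, hg⟩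
    obtain ⟨V, hV, hVo, hfV, hVc⟩ := hbase (P f) _ (inter_mem (hN.mem_nhds hf) hnb)
    -- the sheet over `V ∩ G`
    let R := {v : P ⁻¹' (N ∩ G) | k v = L i (P v)}
    have hRc : IsClosed R := by
      refine isClosed_eq (hk.comp continuous_subtype_val) ?_
      exact (hL i).comp_continuous (hPc.comp continuous_subtype_val) fun v => v.2.1
    let ρ : R → ↥(N ∩ G) := fun v => (N ∩ G).restrictPreimage P v.1
    have hρc : IsClosedMap ρ :=
      (hP.isClosedMap.restrictPreimage (N ∩ G)).comp hRc.isClosedEmbedding_subtypeVal.isClosedMap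
    have hρi : Function.Injective ρ := by
      rintro ⟨⟨v, hv⟩, hv'⟩ ⟨⟨w, hw⟩, hw'⟩ h
      have hvw : P v = P w := congrArg Subtype.val h
      have : v = w := hinj v w hv.2 hvw (by
        have h1 : k v = L i (P v) := hv'
        have h2 : k w = L i (P w) := hw'
        rw [h1, h2, hvw])
      subst this; rfl
    have hρs : Function.Surjective ρ := by
      rintro ⟨x, hx⟩
      obtain ⟨g, hg, hkg⟩ := hsurj x (L i x) (hLβ i x hx.1)
      subst hg
      exact ⟨⟨⟨g, hx⟩, hkg⟩, rfl⟩
    have hVc' : IsPreconnected (Subtype.val ⁻¹' (V ∩ G) : Set ↥(N ∩ G)) := by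
      apply IsInducing.subtypeVal.isPreconnected_image.1
      rw [Subtype.image_preimage_coe, inter_eq_right.2]
      · exact hVc.isPreconnected
      · exact fun x hx => ⟨(hV hx.1).1, hx.2⟩
    have hpre := hVc'.preimage_of_isClosedMap hρi hρc (by rw [hρs.range_eq]; exact subset_univ _)
    have hA := hpre.image (fun v : R => (v.1.1 : F))
      (continuous_subtype_val.comp continuous_subtype_val).continuousOn
    have hmem : ∀ g, P g ∈ V → P g ∈ G → k g = L i (P g) →
        g ∈ (fun v : R => (v.1.1 : F)) '' (ρ ⁻¹' (Subtype.val ⁻¹' (V ∩ G))) := fun g hg hgG hkg =>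
      ⟨⟨⟨g, (hV hg).1, hgG⟩, hkg⟩, ⟨hg, hgG⟩, rfl⟩
    have hAsub : (fun v : R => (v.1.1 : F)) '' (ρ ⁻¹' (Subtype.val ⁻¹' (V ∩ G))) ⊆ W₁ ∪ W₂ := by
      rintro _ ⟨v, hv, rfl⟩
      exact (hV (show P v.1.1 ∈ V from hv.1)).2 _ rfl
    have hmeet : ∀ g W, P g = P f → Q g i → IsOpen W → g ∈ W → ∃ g' ∈ W,
        g' ∈ (fun v : R => (v.1.1 : F)) '' (ρ ⁻¹' (Subtype.val ⁻¹' (V ∩ G))) := by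
      rintro g W hg ⟨U, hUo, hgU, hUN, hU⟩ hW hgW
      obtain ⟨Y, hY, -, -, ⟨v, hvY, hvG⟩, -⟩ := hbranch g (U ∩ W ∩ P ⁻¹' V)
        (((hUo.inter hW).inter (hVo.preimage hPc)).mem_nhds ⟨⟨hgU, hgW⟩, by
          rw [mem_preimage, hg]; exact hfV⟩)
      have hv := hY hvY
      exact ⟨v, hv.1.2, hmem v hv.2 hvG (hU v hv.1.1 hvG)⟩
    obtain ⟨g₁, hg₁, hg₁'⟩ := hmeet f W₁ rfl hQ hW₁ (h₁ rfl)
    obtain ⟨g₂, hg₂, hg₂'⟩ := hmeet f' W₂ hff'.symm hQ' hW₂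
      (h₂ ⟨hff'.symm, fun h => hne (mem_singleton_iff.1 h).symm⟩)
    rcases hA.subset_or_subset hW₁ hW₂ hd hAsub with h | h
    · exact disjoint_left.1 hd (h hg₂') hg₂
    · exact disjoint_left.1 hd hg₁ (h hg₁')
  have hex' : ∀ f : P ⁻¹' N, ∃ i, Q f i := fun f => hex f f.2
  choose idx hidx using hex'
  let Φ : P ⁻¹' N → N × I := fun f => (N.restrictPreimage P f, idx f)
  have hΦc : Continuous Φ := by
    refine Continuous.prodMk (hPc.restrictPreimage) ?_
    rw [continuous_iff_continuousAt]
    rintro ⟨f, hf⟩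
    obtain ⟨U, hUo, hfU, hUN, hU⟩ := hidx ⟨f, hf⟩
    refine (continuousAt_const (y := idx ⟨f, hf⟩)).congr ?_
    filter_upwards [(hUo.preimage continuous_subtype_val).mem_nhds
      (show (⟨f, hf⟩ : P ⁻¹' N) ∈ Subtype.val ⁻¹' U from hfU)] with g hg
    exact huniq g _ _ ⟨U, hUo, hg, hUN, hU⟩ (hidx g)
  have hΦp : IsProperMap Φ := by
    refine isProperMap_of_comp_of_t2 hΦc continuous_fst ?_
    exact hP.restrictPreimage N
  have hΦb : Function.Bijective Φ := by
    constructor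
    · rintro ⟨f, hf⟩ ⟨g, hg⟩ h
      have h1 : P f = P g := congrArg (fun z => (z.1 : X)) h
      have h2 : idx ⟨f, hf⟩ = idx ⟨g, hg⟩ := congrArg Prod.snd h
      exact Subtype.ext (hQinj f g _ hf h1 (hidx ⟨f, hf⟩) (h2 ▸ hidx ⟨g, hg⟩))
    · rintro ⟨⟨x, hx⟩, i⟩
      obtain ⟨f, rfl, hf⟩ := hQsurj x i hx
      exact ⟨⟨f, hx⟩, Prod.ext rfl (huniq f _ _ (hidx ⟨f, hx⟩) hf)⟩
  have hΦh : IsHomeomorph Φ :=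
    isHomeomorph_iff_continuous_isClosedMap_bijective.2 ⟨hΦc, hΦp.isClosedMap, hΦb⟩
  have : IsEvenlyCovered P x₀ I :=
    ⟨inferInstance, N, hx₀, hN, hO, hΦh.homeomorph, fun f => rfl⟩
  exact this.to_isEvenlyCovered_preimage

/-- topological `e`-th root of `f (t ^ e)`. -/
theorem exists_root_comp_pow (f : ℂ → ℂ) (hf : Continuous f) (hf0 : f 0 = 0)
    (hne : ∀ u, u ≠ 0 → f u ≠ 0) (e : ℕ) (he : e ≠ 0) :
    ∃ g : ℂ → ℂ, Continuous g ∧ ∀ t, g t ^ e = f (t ^ e) := by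
  have he' : (e : ℂ) ≠ 0 := by exact_mod_cast he
  obtain ⟨Λ, ⟨-, hΛ⟩, -⟩ := Complex.isCoveringMapOn_exp.existsUnique_continuousMap_lifts
    (⟨fun s => f (Complex.exp s), by fun_prop⟩ : C(ℂ, ℂ)) (a₀ := 0)
    (e₀ := Complex.log (f (Complex.exp 0)))
    (by simpa using Complex.exp_log (hne 1 one_ne_zero))
    (fun s => by simpa using hne _ (Complex.exp_ne_zero s))
  have hΛ' : ∀ s, Complex.exp (Λ s) = f (Complex.exp s) := fun s => congrFun hΛ s
  have hex : ∀ s, ∃ n : ℤ, Λ (s + 2 * Real.pi * Complex.I) = Λ s + n * (2 * Real.pi * Complex.I) := by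
    intro s
    apply Complex.exp_eq_exp_iff_exists_int.1
    rw [hΛ', hΛ', Complex.exp_periodic]
  choose n hn using hex
  have hnc : ∀ s, n s = n 0 := by
    have hcn : Continuous n := by
      have h1 : Continuous fun s => (n s : ℂ) := by
        have : (fun s => (n s : ℂ)) = fun s =>
            (Λ (s + 2 * Real.pi * Complex.I) - Λ s) / (2 * Real.pi * Complex.I) := by
          funext s
          rw [hn s]; field_simp [Complex.two_pi_I_ne_zero]; ring
        rw [this]; fun_prop
      have h2 : Continuous fun s => ((n s : ℤ) : ℝ) := by
        have := Complex.continuous_re.comp h1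
        simpa [Function.comp_def] using this
      exact Int.isClosedEmbedding_coe_real.isInducing.continuous_iff.2 h2
    intro s
    exact PreconnectedSpace.constant (Y := ℤ) inferInstance hcn
  have hper : ∀ (s : ℂ) (m : ℤ), Λ (s + m * (2 * Real.pi * Complex.I)) =
      Λ s + m * n 0 * (2 * Real.pi * Complex.I) := by
    intro s m
    induction m using Int.induction_on with
    | zero => simp
    | succ m ih =>
      have h := hn (s + (m : ℤ) * (2 * Real.pi * Complex.I))
      rw [hnc, ih] at h
      push_cast at h ⊢
      rw [show s + ((m : ℂ) + 1) * (2 * Real.pi * Complex.I) =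
        s + m * (2 * Real.pi * Complex.I) + 2 * Real.pi * Complex.I by ring, h]
      ring
    | pred m ih =>
      have h := hn (s + (-(m : ℤ) - 1 : ℤ) * (2 * Real.pi * Complex.I))
      rw [hnc] at h
      rw [show s + ((-(m : ℤ) - 1 : ℤ) : ℂ) * (2 * Real.pi * Complex.I) + 2 * Real.pi * Complex.I =
        s + ((-(m : ℤ) : ℤ) : ℂ) * (2 * Real.pi * Complex.I) by push_cast; ring, ih] at h
      push_cast at h ⊢
      linear_combination -h
  let g : ℂ → ℂ := fun t => if t = 0 then 0 else Complex.exp (Λ (e * Complex.log t) / e)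
  have hg0 : g 0 = 0 := if_pos rfl
  have hgexp : ∀ s, g (Complex.exp s) = Complex.exp (Λ (e * s) / e) := by
    intro s
    have : g (Complex.exp s) = Complex.exp (Λ (e * Complex.log (Complex.exp s)) / e) :=
      if_neg (Complex.exp_ne_zero s)
    rw [this]
    obtain ⟨m, hm⟩ := Complex.exp_eq_exp_iff_exists_int.1
      (Complex.exp_log (Complex.exp_ne_zero s))
    rw [hm, Complex.exp_eq_exp_iff_exists_int]
    refine ⟨m * n 0, ?_⟩
    have h := hper (e * s) (e * m)
    rw [show (e : ℂ) * (s + m * (2 * Real.pi * Complex.I)) =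
      e * s + ((e * m : ℤ) : ℂ) * (2 * Real.pi * Complex.I) by push_cast; ring, h]
    push_cast
    field_simp
  have hgpow : ∀ t, g t ^ e = f (t ^ e) := by
    intro t
    by_cases ht : t = 0
    · subst ht; simp [hg0, hf0, he]
    · have : t = Complex.exp (Complex.log t) := (Complex.exp_log ht).symm
      rw [this, hgexp, ← Complex.exp_nat_mul, ← Complex.exp_nat_mul, mul_div_cancel₀ _ he', hΛ']
  refine ⟨g, ?_, hgpow⟩
  rw [continuous_iff_continuousAt]
  intro t
  by_cases ht : t = 0
  · subst ht
    unfold ContinuousAt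
    rw [hg0, tendsto_zero_iff_norm_tendsto_zero]
    have h1 : Tendsto (fun t => ‖f (t ^ e)‖) (𝓝 0) (𝓝 0) := by
      have : Continuous fun t : ℂ => ‖f (t ^ e)‖ := by fun_prop
      simpa [he, hf0] using this.tendsto 0
    have h2 : Tendsto (fun t => ‖g t‖ ^ e) (𝓝 0) (𝓝 0) := by
      simpa [← norm_pow, hgpow] using h1
    have h3 := h2.rpow_const (p := (e : ℝ)⁻¹) (Or.inr (by positivity))
    rw [Real.zero_rpow (by positivity)] at h3
    simpa [Real.pow_rpow_inv_natCast, he] using h3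
  · -- a local branch of the logarithm near `t`
    have hloc : ∀ᶠ z in 𝓝 t, g z = Complex.exp (Λ (e * (Complex.log t + Complex.log (z / t))) / e) := by
      have hz : ∀ᶠ z in 𝓝 t, z ≠ 0 := isOpen_ne.mem_nhds ht
      filter_upwards [hz] with z hz
      rw [← hgexp, Complex.exp_add, Complex.exp_log ht, Complex.exp_log (div_ne_zero hz ht),
        mul_div_cancel₀ _ ht]
    refine ContinuousAt.congr ?_ (hloc.mono fun _ h => h.symm)
    have hl : ContinuousAt (fun z => Complex.log (z / t)) t := by
      refine ContinuousAt.clog (by fun_prop) ?_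
      rw [div_self ht]; exact Complex.one_mem_slitPlane
    refine Complex.continuous_exp.continuousAt.comp ?_
    refine ContinuousAt.div_const ?_ _
    exact Λ.continuous.continuousAt.comp (continuousAt_const.mul (continuousAt_const.add hl))

theorem exists_connected_punctured (u₀ : ℂ) (M : Set ℂ) (hM : M ∈ 𝓝 u₀) :
    ∃ B ⊆ M, IsOpen B ∧ u₀ ∈ B ∧ IsConnected (B ∩ {0}ᶜ) := by
  by_cases h0 : u₀ = 0
  · subst h0
    obtain ⟨δ, hδ, hB⟩ := Metric.mem_nhds_iff.1 hM
    refine ⟨_, hB, Metric.isOpen_ball, Metric.mem_ball_self hδ, ?_⟩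
    have hconv : Convex ℝ {s : ℂ | s.re < Real.log δ} := convex_halfSpace_re_lt _
    have hconn : IsConnected {s : ℂ | s.re < Real.log δ} :=
      ⟨⟨((Real.log δ - 1 : ℝ) : ℂ), by
        show ((Real.log δ - 1 : ℝ) : ℂ).re < _
        rw [Complex.ofReal_re]; linarith⟩, hconv.isPreconnected⟩
    convert hconn.image Complex.exp Complex.continuous_exp.continuousOn using 1
    ext z
    simp only [mem_inter_iff, Metric.mem_ball, dist_zero_right, mem_compl_iff, mem_singleton_iff,
      mem_image, mem_ofPred_eq]
    constructor
    · rintro ⟨h1, h2⟩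
      refine ⟨Complex.log z, ?_, Complex.exp_log h2⟩
      rw [Complex.log_re]
      exact Real.log_lt_log (norm_pos_iff.2 h2) h1
    · rintro ⟨s, hs, rfl⟩
      refine ⟨?_, Complex.exp_ne_zero s⟩
      rw [Complex.norm_exp]
      exact (Real.lt_log_iff_exp_lt hδ).1 hs
  · obtain ⟨δ, hδ, hB⟩ := Metric.mem_nhds_iff.1 (inter_mem hM (isOpen_ne.mem_nhds h0))
    refine ⟨_, fun x hx => (hB hx).1, Metric.isOpen_ball, Metric.mem_ball_self hδ, ?_⟩
    have h1 : Metric.ball u₀ δ ∩ {0}ᶜ = Metric.ball u₀ δ := inter_eq_left.2 fun x hx => (hB hx).2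
    rw [h1]
    exact Metric.isConnected_ball hδ

/-- local structure of the surface -/
theorem surface_base {X : Type*} [TopologicalSpace X] (u v w : X → ℂ)
    (hemb : IsEmbedding fun x => (u x, v x, w x)) (A B D : ℂ) (hB : B ≠ 0) (l m n : ℕ)
    (hm : m ≠ 0)
    (heq : ∀ x, A * u x ^ l + B * v x ^ m + D * w x ^ n = 0)
    (hmk : ∀ u' v' w' : ℂ, A * u' ^ l + B * v' ^ m + D * w' ^ n = 0 → v' ≠ 0 →
      ∃ x, u x = u' ∧ v x = v' ∧ w x = w')
    (s : X) (hv : v s ≠ 0) (hw : w s ≠ 0) (M : Set X) (hM : M ∈ 𝓝 s) :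
    ∃ N ⊆ M, IsOpen N ∧ s ∈ N ∧ IsConnected (N ∩ {x | u x ≠ 0 ∧ v x ≠ 0 ∧ w x ≠ 0}) := by
  have hind := hemb.isInducing
  have hc := hind.continuous
  have huc : Continuous u := continuous_fst.comp hc
  have hvc : Continuous v := continuous_fst.comp (continuous_snd.comp hc)
  have hwc : Continuous w := continuous_snd.comp (continuous_snd.comp hc)
  obtain ⟨E, hsE, hE⟩ := (isCoveringMapOn_npow (𝕜 := ℂ) m (by exact_mod_cast hm)).isLocalHomeomorphOn
    (v s) (by simp [hm, hv])
  have hE' : ∀ y, E y = y ^ m := fun y => (congrFun hE y).symm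
  let h : ℂ × ℂ → ℂ := fun y => -(A * y.1 ^ l + D * y.2 ^ n) / B
  have hh : Continuous h := by fun_prop
  have hhx : ∀ x, h (u x, w x) = v x ^ m := by
    intro x
    simp only [h]
    rw [div_eq_iff hB]; linear_combination - heq x
  let Y : ℂ × ℂ → ℂ := fun y => E.symm (h y)
  have hYs : Y (u s, w s) = v s := by
    simp only [Y]; rw [hhx, ← hE', E.left_inv hsE]
  have hts : h (u s, w s) ∈ E.target := by rw [hhx, ← hE']; exact E.map_source hsE
  have hYc : ContinuousAt Y (u s, w s) :=
    (E.continuousAt_symm hts).comp hh.continuousAt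
  rw [hind.nhds_eq_comap, mem_comap] at hM
  obtain ⟨M', hM', hMM'⟩ := hM
  have hYc' : ContinuousAt (fun y : ℂ × ℂ => (y.1, Y y, y.2)) (u s, w s) :=
    continuousAt_fst.prodMk (hYc.prodMk continuousAt_snd)
  have hnb : {y : ℂ × ℂ | h y ∈ E.target ∧ (y.1, Y y, y.2) ∈ M' ∧ Y y ≠ 0 ∧ y.2 ≠ 0} ∈
      𝓝 (u s, w s) := by
    have e1 : ∀ᶠ y in 𝓝 (u s, w s), h y ∈ E.target :=
      hh.continuousAt.eventually (E.open_target.mem_nhds hts)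
    have e2 : ∀ᶠ y : ℂ × ℂ in 𝓝 (u s, w s), (y.1, Y y, y.2) ∈ M' :=
      hYc' (by simpa only [hYs] using hM')
    have e3 : ∀ᶠ y in 𝓝 (u s, w s), Y y ≠ 0 :=
      hYc.eventually_ne (by rw [hYs]; exact hv)
    have e4 : ∀ᶠ y : ℂ × ℂ in 𝓝 (u s, w s), y.2 ≠ 0 :=
      continuousAt_snd.eventually_ne hw
    filter_upwards [e1, e2, e3, e4] with y h1 h2 h3 h4
    exact ⟨h1, h2, h3, h4⟩
  rw [nhds_prod_eq, mem_prod_iff] at hnb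
  obtain ⟨M₁, hM₁, M₂, hM₂, hM₁₂⟩ := hnb
  obtain ⟨B₁, hB₁, hB₁o, hsB₁, hB₁c⟩ := exists_connected_punctured _ M₁ hM₁
  obtain ⟨δ, hδ, hB₂⟩ := Metric.mem_nhds_iff.1 hM₂
  have hsub : ∀ y : ℂ × ℂ, y.1 ∈ B₁ → y.2 ∈ Metric.ball (w s) δ →
      h y ∈ E.target ∧ (y.1, Y y, y.2) ∈ M' ∧ Y y ≠ 0 ∧ y.2 ≠ 0 := fun y h1 h2 =>
    hM₁₂ ⟨hB₁ h1, hB₂ h2⟩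
  have hYx : ∀ x, v x ∈ E.source → Y (u x, w x) = v x := by
    intro x hx
    simp only [Y]; rw [hhx, ← hE', E.left_inv hx]
  have hex : ∀ y : ℂ × ℂ, ∃ x, (h y ∈ E.target → Y y ≠ 0 → u x = y.1 ∧ v x = Y y ∧ w x = y.2) := by
    intro y
    by_cases hy : h y ∈ E.target ∧ Y y ≠ 0
    · obtain ⟨x, hx⟩ := hmk y.1 (Y y) y.2 (by
        have : Y y ^ m = h y := by rw [← hE']; exact E.right_inv hy.1
        rw [this]; simp only [h]; field_simp; ring) hy.2
      exact ⟨x, fun _ _ => hx⟩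
    · exact ⟨s, fun h1 h2 => (hy ⟨h1, h2⟩).elim⟩
  choose σ hσ using hex
  refine ⟨{x | u x ∈ B₁ ∧ w x ∈ Metric.ball (w s) δ ∧ v x ∈ E.source}, ?_, ?_, ?_, ?_⟩
  · rintro x ⟨h1, h2, h3⟩
    apply hMM'
    have := (hsub (u x, w x) h1 h2).2.1
    rwa [hYx x h3] at this
  · exact (hB₁o.preimage huc).inter ((Metric.isOpen_ball.preimage hwc).inter
      (E.open_source.preimage hvc))
  · exact ⟨hsB₁, Metric.mem_ball_self hδ, hsE⟩
  · have hconn : IsConnected ((B₁ ∩ {0}ᶜ) ×ˢ Metric.ball (w s) δ) :=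
      hB₁c.prod (Metric.isConnected_ball hδ)
    have hσc : ContinuousOn σ ((B₁ ∩ {0}ᶜ) ×ˢ Metric.ball (w s) δ) := by
      rw [hind.continuousOn_iff]
      have : ContinuousOn (fun y : ℂ × ℂ => (y.1, Y y, y.2))
          ((B₁ ∩ {0}ᶜ) ×ˢ Metric.ball (w s) δ) := by
        refine continuousOn_fst.prodMk (ContinuousOn.prodMk ?_ continuousOn_snd)
        exact E.continuousOn_symm.comp hh.continuousOn fun y hy => (hsub y hy.1.1 hy.2).1
      refine this.congr fun y hy => ?_
      obtain ⟨h1, -, h3, -⟩ := hsub y hy.1.1 hy.2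
      obtain ⟨a1, a2, a3⟩ := hσ y h1 h3
      simp [a1, a2, a3]
    convert hconn.image σ hσc using 1
    ext x
    constructor
    · rintro ⟨⟨h1, h2, h3⟩, h4, h5, h6⟩
      refine ⟨(u x, w x), ⟨⟨h1, h4⟩, h2⟩, ?_⟩
      obtain ⟨b1, -, b3, -⟩ := hsub (u x, w x) h1 h2
      obtain ⟨a1, a2, a3⟩ := hσ (u x, w x) b1 b3
      apply hemb.injective
      simp only [a1, a2, a3, hYx x h3]
    · rintro ⟨y, hy, rfl⟩
      obtain ⟨h1, -, h3, h4⟩ := hsub y hy.1.1 hy.2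
      obtain ⟨a1, a2, a3⟩ := hσ y h1 h3
      refine ⟨⟨?_, ?_, ?_⟩, ?_, ?_, ?_⟩
      · rw [a1]; exact hy.1.1
      · rw [a3]; exact hy.2
      · rw [a2]; exact E.map_target h1
      · rw [a1]; exact hy.1.2
      · rw [a2]; exact h3
      · rw [a3]; exact h4
/-- Local lifts through one ramified point. -/
theorem local_lifts {C : Type*} [TopologicalSpace C] (π : C → OnePoint ℂ)
    (γ : C) (x₀ : OnePoint ℂ) (e : ℕ) (he : e ≠ 0) (hmod : HasLocalPowerModel π γ x₀ e)
    (κ : ℂ → OnePoint ℂ) (hκ : Continuous κ) (hκi : Function.Injective κ) (hκ0 : κ 0 = x₀) :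
    ∃ (U : Set C) (ε : ℝ) (Λ : {ζ : ℂ // ζ ^ e = 1} → ℂ → C), IsOpen U ∧ γ ∈ U ∧ 0 < ε ∧
      (∀ ζ, ContinuousOn (Λ ζ) (Metric.ball 0 ε)) ∧ (∀ ζ, Λ ζ 0 = γ) ∧
      (∀ ζ, ∀ t ∈ Metric.ball (0 : ℂ) ε, κ (t ^ e) = π (Λ ζ t)) ∧
      (∀ ζ ζ', ∀ t ∈ Metric.ball (0 : ℂ) ε, t ≠ 0 → Λ ζ t = Λ ζ' t → ζ = ζ') ∧
      (∀ t ∈ Metric.ball (0 : ℂ) ε, ∀ c ∈ U, π c = κ (t ^ e) → ∃ ζ, Λ ζ t = c) := by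
  classical
  obtain ⟨U, V, hU, hγ, hV, hx, hf, φ, ψ, hφ, hψ, hmod⟩ := hmod
  have hVn : κ ⁻¹' V ∈ 𝓝 (0 : ℂ) := (hV.preimage hκ).mem_nhds (by rw [mem_preimage, hκ0]; exact hx)
  obtain ⟨δ, hδ, hball⟩ := Metric.nhds_basis_closedBall.mem_iff.1 hVn
  -- retraction on a closed ball
  let ret : ℂ → ℂ := fun u => ((δ / max δ ‖u‖ : ℝ) : ℂ) * u
  have hmax : ∀ u : ℂ, 0 < max δ ‖u‖ := fun u => lt_of_lt_of_le hδ (le_max_left _ _)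
  have hretc : Continuous ret := by
    refine (Complex.continuous_ofReal.comp ?_).mul continuous_id
    exact continuous_const.div (by fun_prop) fun u => (hmax u).ne'
  have hretV : ∀ u, κ (ret u) ∈ V := by
    intro u
    apply hball
    rw [mem_closedBall_zero_iff, norm_mul, Complex.norm_real, Real.norm_of_nonneg
      (div_nonneg hδ.le (hmax u).le), div_mul_eq_mul_div, div_le_iff₀ (hmax u)]
    exact mul_le_mul_of_nonneg_left (le_max_right _ _) hδ.le
  have hretid : ∀ u : ℂ, ‖u‖ ≤ δ → ret u = u := by
    intro u hu
    simp only [ret]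
    rw [max_eq_left hu, div_self hδ.ne']; simp
  have hret0 : ret 0 = 0 := by simp [ret]
  have hretne : ∀ u, u ≠ 0 → ret u ≠ 0 := by
    intro u hu
    simp only [ret]
    refine mul_ne_zero ?_ hu
    exact_mod_cast (div_pos hδ (hmax u)).ne'
  let f : ℂ → ℂ := fun u => (ψ ⟨κ (ret u), hretV u⟩ : ℂ)
  have hfc : Continuous f :=
    continuous_subtype_val.comp (ψ.continuous.comp ((hκ.comp hretc).subtype_mk _))
  have hf0 : f 0 = 0 := by
    have h0 : κ (ret 0) = x₀ := by rw [hret0, hκ0]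
    have : (⟨κ (ret 0), hretV 0⟩ : V) = ⟨x₀, hx⟩ := Subtype.ext h0
    simp only [f]; rw [this, hψ]
  have hfne : ∀ u, u ≠ 0 → f u ≠ 0 := by
    intro u hu h0
    have h1 : ψ ⟨κ (ret u), hretV u⟩ = ψ ⟨x₀, hx⟩ := Subtype.ext (by rw [hψ]; exact h0)
    have h2 : κ (ret u) = x₀ := congrArg Subtype.val (ψ.injective h1)
    rw [← hκ0] at h2
    exact hretne u hu (hκi h2)
  obtain ⟨g, hgc, hg⟩ := exists_root_comp_pow f hfc hf0 hfne e he
  have hgnorm : ∀ t, ‖g t‖ < 1 := by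
    intro t
    have h1 : ‖g t‖ ^ e < 1 := by
      rw [← norm_pow, hg]
      exact mem_ball_zero_iff.1 (ψ ⟨κ (ret (t ^ e)), hretV _⟩).2
    exact (pow_lt_one_iff_of_nonneg (norm_nonneg _) he).1 h1
  have hζn : ∀ ζ : {ζ : ℂ // ζ ^ e = 1}, ‖ζ.1‖ = 1 := fun ζ => by
    have h := congrArg norm ζ.2
    rw [norm_pow, norm_one] at h
    exact (pow_eq_one_iff_of_nonneg (norm_nonneg _) he).1 h
  have hmemb : ∀ (ζ : {ζ : ℂ // ζ ^ e = 1}) t, ζ.1 * g t ∈ Metric.ball (0 : ℂ) 1 := by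
    intro ζ t
    rw [mem_ball_zero_iff, norm_mul, hζn, one_mul]
    exact hgnorm t
  let Λ : {ζ : ℂ // ζ ^ e = 1} → ℂ → C := fun ζ t => (φ.symm ⟨ζ.1 * g t, hmemb ζ t⟩ : C)
  have hΛc : ∀ ζ, Continuous (Λ ζ) := fun ζ =>
    continuous_subtype_val.comp (φ.symm.continuous.comp ((continuous_const.mul hgc).subtype_mk _))
  have hεex : {t : ℂ | ‖t ^ e‖ < δ} ∈ 𝓝 (0 : ℂ) := by
    refine IsOpen.mem_nhds (isOpen_lt (by fun_prop) continuous_const) ?_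
    simp [he, hδ]
  obtain ⟨ε, hε, hεb⟩ := Metric.mem_nhds_iff.1 hεex
  have hκV : ∀ t ∈ Metric.ball (0 : ℂ) ε, ret (t ^ e) = t ^ e := fun t ht =>
    hretid _ (le_of_lt (hεb ht))
  have hg0 : g 0 = 0 := by
    have := hg 0
    rw [zero_pow he, hf0] at this
    exact pow_eq_zero_iff he |>.1 this
  have hgne : ∀ t, t ≠ 0 → g t ≠ 0 := by
    intro t ht h0
    have := hg t
    rw [h0, zero_pow he] at this
    exact hfne _ (pow_ne_zero e ht) this.symm
  refine ⟨U, ε, Λ, hU, hγ, hε, fun ζ => (hΛc ζ).continuousOn, ?_, ?_, ?_, ?_⟩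
  · intro ζ
    have : (⟨ζ.1 * g 0, hmemb ζ 0⟩ : Metric.ball (0 : ℂ) 1) = φ ⟨γ, hγ⟩ :=
      Subtype.ext ((show ζ.1 * g 0 = 0 by rw [hg0, mul_zero]).trans hφ.symm)
    simp only [Λ]
    rw [this, φ.symm_apply_apply]
  · intro ζ t ht
    have h1 := hmod (φ.symm ⟨ζ.1 * g t, hmemb ζ t⟩)
    rw [φ.apply_symm_apply] at h1
    simp only [mul_pow, ζ.2, one_mul, hg] at h1
    have h2 := ψ.injective (Subtype.ext h1)
    have h3 := congrArg Subtype.val h2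
    simp only [hκV t ht] at h3
    exact h3.symm
  · intro ζ ζ' t ht ht0 h
    have h1 := φ.symm.injective (Subtype.ext h)
    have h2 : ζ.1 * g t = ζ'.1 * g t := congrArg Subtype.val h1
    exact Subtype.ext (mul_right_cancel₀ (hgne t ht0) h2)
  · intro t ht c hc hπ
    have h1 := hmod ⟨c, hc⟩
    have h2 : (φ ⟨c, hc⟩ : ℂ) ^ e = g t ^ e := by
      rw [← h1, hg]
      simp only [f]
      congr 3
      rw [hκV t ht]; exact hπ
    by_cases ht0 : t = 0
    · subst ht0
      rw [hg0, zero_pow he, pow_eq_zero_iff he] at h2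
      refine ⟨⟨1, one_pow e⟩, ?_⟩
      have : (⟨1 * g 0, hmemb ⟨1, one_pow e⟩ 0⟩ : Metric.ball (0 : ℂ) 1) = φ ⟨c, hc⟩ :=
        Subtype.ext ((show 1 * g 0 = 0 by rw [hg0, mul_zero]).trans h2.symm)
      simp only [Λ]
      rw [this, φ.symm_apply_apply]
    · have hgt := hgne t ht0
      refine ⟨⟨(φ ⟨c, hc⟩ : ℂ) / g t, by rw [div_pow, h2, div_self (pow_ne_zero e hgt)]⟩, ?_⟩
      simp only [Λ, div_mul_cancel₀ _ hgt, Subtype.coe_eta, φ.symm_apply_apply]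

/-- Section data near a point whose image in the sphere is a branch point. -/
theorem sections_bad {C : Type} {X : Type*} [TopologicalSpace C] [TopologicalSpace X] [CompactSpace C]
    [T2Space C] (π : C → OnePoint ℂ) (hπ : Continuous π)
    (x₀ : OnePoint ℂ) (hfin : (π ⁻¹' {x₀}).Finite) (e : ℕ) (he : e ≠ 0)
    (hmod : ∀ γ, π γ = x₀ → HasLocalPowerModel π γ x₀ e)
    (κ : ℂ → OnePoint ℂ) (hκ : Continuous κ) (hκi : Function.Injective κ) (hκ0 : κ 0 = x₀)
    (β : X → OnePoint ℂ) (s : X) (N₀ : Set X) (hN₀ : IsOpen N₀) (hs : s ∈ N₀) (t : X → ℂ)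
    (ht : ContinuousOn t N₀) (hts : t s = 0) (hβ : ∀ x ∈ N₀, β x = κ (t x ^ e)) :
    ∃ (N : Set X) (I : Type) (_ : Finite I) (L : I → X → C), IsOpen N ∧ s ∈ N ∧
      (∀ i, ContinuousOn (L i) N) ∧ (∀ i, ∀ x ∈ N, β x = π (L i x)) ∧
      (∀ x ∈ N, β x ≠ x₀ → ∀ γ, π γ = β x → ∃! i, L i x = γ) := by
  classical
  have hll : ∀ γ : π ⁻¹' {x₀}, _ := fun γ => local_lifts π γ.1 x₀ e he (hmod γ.1 γ.2) κ hκ hκi hκ0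
  choose U ε Λ hU hγU hε hΛc hΛ0 hΛπ hΛi hΛs using hll
  have : Finite (π ⁻¹' {x₀}) := hfin
  obtain ⟨A, hA, hAd⟩ := hfin.t2_separation
  let A' : π ⁻¹' {x₀} → Set C := fun γ => A γ ∩ U γ
  have hA'o : ∀ γ, IsOpen (A' γ) := fun γ => (hA γ).2.inter (hU γ)
  have hA'm : ∀ γ, γ.1 ∈ A' γ := fun γ => ⟨(hA γ).1, hγU γ⟩
  have hnb : {x | ∀ c, π c = x → ∃ γ, c ∈ A' γ} ∈ 𝓝 x₀ := by
    have hc := hπ.isClosedMap _ (isOpen_iUnion hA'o).isClosed_compl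
    filter_upwards [hc.isOpen_compl.mem_nhds (x := x₀) (by
      rintro ⟨c, hc, hcx⟩
      exact hc (mem_iUnion.2 ⟨⟨c, hcx⟩, hA'm ⟨c, hcx⟩⟩))] with x hx c hcx
    by_contra h
    exact hx ⟨c, fun h' => h (mem_iUnion.1 h'), hcx⟩
  have hI : Finite {ζ : ℂ // ζ ^ e = 1} := by
    have : ({ζ : ℂ | ζ ^ e = 1}).Finite := by
      refine (Polynomial.nthRoots e (1 : ℂ)).toFinset.finite_toSet.subset fun ζ hζ => ?_
      simpa [Polynomial.mem_nthRoots (Nat.pos_of_ne_zero he)] using hζ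
    exact this
  -- good set of parameters
  have hT : {τ : ℂ | (∀ γ, τ ∈ Metric.ball (0 : ℂ) (ε γ)) ∧ (∀ γ ζ, Λ γ ζ τ ∈ A' γ) ∧
      (∀ c, π c = κ (τ ^ e) → ∃ γ, c ∈ A' γ)} ∈ 𝓝 (0 : ℂ) := by
    have e1 : ∀ᶠ τ in 𝓝 (0 : ℂ), ∀ γ, τ ∈ Metric.ball (0 : ℂ) (ε γ) :=
      eventually_all.2 fun γ => Metric.ball_mem_nhds _ (hε γ)
    have e2 : ∀ᶠ τ in 𝓝 (0 : ℂ), ∀ γ ζ, Λ γ ζ τ ∈ A' γ := by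
      refine eventually_all.2 fun γ => eventually_all.2 fun ζ => ?_
      have hca := (hΛc γ ζ).continuousAt (Metric.ball_mem_nhds 0 (hε γ))
      refine hca.eventually_mem ((hA'o γ).mem_nhds ?_)
      rw [hΛ0]; exact hA'm γ
    have e3 : ∀ᶠ τ in 𝓝 (0 : ℂ), ∀ c, π c = κ (τ ^ e) → ∃ γ, c ∈ A' γ := by
      have hc : ContinuousAt (fun τ : ℂ => κ (τ ^ e)) 0 := by fun_prop
      have hnb' : {x | ∀ c, π c = x → ∃ γ, c ∈ A' γ} ∈ 𝓝 (κ ((0 : ℂ) ^ e)) := by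
        rw [zero_pow he, hκ0]; exact hnb
      exact hc hnb'
    filter_upwards [e1, e2, e3] with τ h1 h2 h3
    exact ⟨h1, h2, h3⟩
  obtain ⟨T, hTs, hTo, h0T⟩ := mem_nhds_iff.1 hT
  refine ⟨N₀ ∩ t ⁻¹' T, (π ⁻¹' {x₀}) × {ζ : ℂ // ζ ^ e = 1}, inferInstance,
    fun i x => Λ i.1 i.2 (t x), ht.isOpen_inter_preimage hN₀ hTo,
    ⟨hs, by rw [mem_preimage, hts]; exact h0T⟩, ?_, ?_, ?_⟩
  · rintro ⟨γ, ζ⟩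
    exact (hΛc γ ζ).comp (ht.mono inter_subset_left) fun x hx => (hTs hx.2).1 γ
  · rintro ⟨γ, ζ⟩ x hx
    rw [hβ x hx.1]
    exact hΛπ γ ζ _ ((hTs hx.2).1 γ)
  · intro x hx hne c hc
    have ht0 : t x ≠ 0 := by
      intro h
      apply hne
      rw [hβ x hx.1, h, zero_pow he, hκ0]
    obtain ⟨h1, h2, h3⟩ := hTs hx.2
    rw [hβ x hx.1] at hc
    obtain ⟨γ, hγ⟩ := h3 c hc
    obtain ⟨ζ, hζ⟩ := hΛs γ _ (h1 γ) c hγ.2 hc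
    refine ⟨(γ, ζ), hζ, ?_⟩
    rintro ⟨γ', ζ'⟩ h'
    have h' : Λ γ' ζ' (t x) = c := h'
    have hγγ : γ' = γ := by
      by_contra hne'
      have hd := hAd γ'.2 γ.2 (fun h => hne' (Subtype.ext h))
      exact disjoint_left.1 hd (h' ▸ (h2 γ' ζ').1) hγ.1
    subst hγγ
    rw [hΛi γ' ζ' ζ _ (h1 γ') ht0 (h'.trans hζ.symm)]

/-- Section data near a point whose image in the sphere is not a branch point. -/
theorem sections_good {C : Type} {X B : Type*} [TopologicalSpace C] [TopologicalSpace X]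
    [TopologicalSpace B] (π : C → B) (β : X → B) (hβ : Continuous β) (s : X)
    (hfin : (π ⁻¹' {β s}).Finite) (hcov : IsEvenlyCovered π (β s) (π ⁻¹' {β s})) :
    ∃ (N : Set X) (I : Type) (_ : Finite I) (L : I → X → C), IsOpen N ∧ s ∈ N ∧
      (∀ i, ContinuousOn (L i) N) ∧ (∀ i, ∀ x ∈ N, β x = π (L i x)) ∧
      (∀ x ∈ N, ∀ γ, π γ = β x → ∃! i, L i x = γ) := by
  classical
  obtain ⟨-, V, hsV, hV, -, H, hH⟩ := hcov
  refine ⟨β ⁻¹' V, π ⁻¹' {β s}, hfin,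
    fun i x => if h : β x ∈ V then (H.symm (⟨β x, h⟩, i) : C) else i.1, hV.preimage hβ, hsV,
    ?_, ?_, ?_⟩
  · intro i
    rw [continuousOn_iff_continuous_domRestrict]
    have : Continuous fun x : β ⁻¹' V => (H.symm (⟨β x, x.2⟩, i) : C) :=
      continuous_subtype_val.comp (H.symm.continuous.comp
        (((hβ.comp continuous_subtype_val).subtype_mk _).prodMk continuous_const))
    refine this.congr fun x => ?_
    have hx : β x ∈ V := x.2
    simp [domRestrict, hx]
  · intro i x hx
    have hx : β x ∈ V := hx
    simp only [hx, dif_pos]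
    rw [← hH, H.apply_symm_apply]
  · intro x hx γ hγ
    have hx : β x ∈ V := hx
    have hγV : γ ∈ π ⁻¹' V := by rw [mem_preimage, hγ]; exact hx
    have h1 : (H ⟨γ, hγV⟩).1 = ⟨β x, hx⟩ := Subtype.ext (by rw [hH]; exact hγ)
    refine ⟨(H ⟨γ, hγV⟩).2, ?_, ?_⟩
    · simp only [hx, dif_pos]
      rw [← h1, Prod.mk.eta, H.symm_apply_apply]
    · intro i hi
      simp only [hx, dif_pos] at hi
      have : H ⟨γ, hγV⟩ = (⟨β x, hx⟩, i) := by
        rw [← H.apply_symm_apply (⟨β x, hx⟩, i)]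
        congr 1
        exact Subtype.ext hi.symm
      rw [this]

theorem exists_local_root {X : Type*} [TopologicalSpace X] (h : X → ℂ) (s : X) (N₀ : Set X)
    (hN₀ : IsOpen N₀) (hs : s ∈ N₀) (hh : ContinuousOn h N₀) (hne : h s ≠ 0) (n : ℕ) (hn : n ≠ 0) :
    ∃ (N : Set X) (w : X → ℂ), N ⊆ N₀ ∧ IsOpen N ∧ s ∈ N ∧ ContinuousOn w N ∧
      ∀ x ∈ N, w x ^ n = h x := by
  obtain ⟨ρ, hρ⟩ := IsAlgClosed.exists_pow_nat_eq (h s) (Nat.pos_of_ne_zero hn)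
  refine ⟨N₀ ∩ (fun x => h x / h s) ⁻¹' Complex.slitPlane,
    fun x => ρ * (h x / h s) ^ ((n : ℂ)⁻¹), inter_subset_left,
    (hh.div_const _).isOpen_inter_preimage hN₀ Complex.isOpen_slitPlane, ⟨hs, ?_⟩, ?_, ?_⟩
  · rw [mem_preimage, div_self hne]; exact Complex.one_mem_slitPlane
  · refine continuousOn_const.mul (ContinuousOn.cpow_const ?_ fun x hx => hx.2)
    exact (hh.div_const _).mono inter_subset_left
  · intro x hx
    rw [mul_pow, hρ, Complex.cpow_nat_inv_pow _ hn, mul_div_cancel₀ _ hne]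

/-- the chart at infinity -/
noncomputable def kinf (u : ℂ) : OnePoint ℂ := if u = 0 then OnePoint.infty else ((u⁻¹ : ℂ) : OnePoint ℂ)

theorem kinf_continuous : Continuous kinf := by
  classical
  rw [continuous_iff_continuousAt]
  intro u
  by_cases hu : u = 0
  · subst hu
    have h0 : kinf 0 = OnePoint.infty := if_pos rfl
    rw [continuousAt_iff_punctured_nhds, h0]
    have h1 : Tendsto (fun u : ℂ => ((u⁻¹ : ℂ) : OnePoint ℂ)) (𝓝[≠] 0) (𝓝 OnePoint.infty) := by
      have := OnePoint.tendsto_coe_infty (X := ℂ)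
      rw [coclosedCompact_eq_cocompact, ← Metric.cobounded_eq_cocompact] at this
      exact this.comp tendsto_inv₀_nhdsNE_zero
    refine h1.congr' ?_
    filter_upwards [self_mem_nhdsWithin] with v hv
    exact (if_neg hv).symm
  · have : ContinuousAt (fun u : ℂ => ((u⁻¹ : ℂ) : OnePoint ℂ)) u :=
      OnePoint.continuous_coe.continuousAt.comp (continuousAt_inv₀ hu)
    refine this.congr ?_
    filter_upwards [isOpen_ne.mem_nhds hu] with v hv
    exact (if_neg hv).symm

theorem kinf_injective : Function.Injective kinf := by
  intro u v h
  unfold kinf at h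
  split_ifs at h with h1 h2 h2
  · rw [h1, h2]
  · exact (OnePoint.infty_ne_coe _ h).elim
  · exact (OnePoint.coe_ne_infty _ h).elim
  · exact inv_injective (OnePoint.coe_injective h)

theorem surface_cases {a b c : ℤ} {p q r : ℕ} (hp : p ≠ 0) (hq : q ≠ 0) (hr : r ≠ 0)
    (ha : a ≠ 0) (hb : b ≠ 0) (hc : c ≠ 0) (s : FermatSurface a b c p q r) :
    (s.1.2.1 ≠ 0 ∧ s.1.2.2 ≠ 0) ∨ (s.1.2.1 = 0 ∧ s.1.1 ≠ 0 ∧ s.1.2.2 ≠ 0) ∨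
      (s.1.2.2 = 0 ∧ s.1.1 ≠ 0 ∧ s.1.2.1 ≠ 0) := by
  obtain ⟨⟨x, y, z⟩, h, hne⟩ := s
  have ha' : (a : ℂ) ≠ 0 := by exact_mod_cast ha
  have hb' : (b : ℂ) ≠ 0 := by exact_mod_cast hb
  have hc' : (c : ℂ) ≠ 0 := by exact_mod_cast hc
  simp only at h ⊢
  by_cases hy : y = 0
  · subst hy
    by_cases hz : z = 0
    · subst hz
      simp [hq, hr, ha', hp] at h
      subst h
      exact (hne rfl).elim
    · refine Or.inr (Or.inl ⟨rfl, ?_, hz⟩)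
      rintro rfl
      simp [hp, hq, hr, hc', hz] at h
  · by_cases hz : z = 0
    · subst hz
      refine Or.inr (Or.inr ⟨rfl, ?_, hy⟩)
      rintro rfl
      simp [hp, hr, hb', hy] at h
    · exact Or.inl ⟨hy, hz⟩

theorem beta_coe {a c : ℤ} {p r : ℕ} (hc : c ≠ 0) (v : ℂ × ℂ × ℂ) (hz : v.2.2 ≠ 0) :
    beta a c p r v = (((a : ℂ) * v.1 ^ p / ((c : ℂ) * v.2.2 ^ r) : ℂ) : OnePoint ℂ) :=
  if_neg (mul_ne_zero (by exact_mod_cast hc) (pow_ne_zero _ hz))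

theorem beta_infty {a c : ℤ} {p r : ℕ} (hr : r ≠ 0) (v : ℂ × ℂ × ℂ) (hz : v.2.2 = 0) :
    beta a c p r v = OnePoint.infty :=
  if_pos (by rw [hz, zero_pow hr, mul_zero])

theorem beta_kinf {a c : ℤ} {p r : ℕ} (hr : r ≠ 0) (ha : a ≠ 0) (hc : c ≠ 0) (v : ℂ × ℂ × ℂ)
    (hx : v.1 ≠ 0) :
    beta a c p r v = kinf ((c : ℂ) * v.2.2 ^ r / ((a : ℂ) * v.1 ^ p)) := by
  have ha' : (a : ℂ) ≠ 0 := by exact_mod_cast ha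
  have hc' : (c : ℂ) ≠ 0 := by exact_mod_cast hc
  by_cases hz : v.2.2 = 0
  · rw [beta_infty hr v hz, hz, zero_pow hr, mul_zero, zero_div]
    exact (if_pos rfl).symm
  · rw [beta_coe hc v hz]
    have : (c : ℂ) * v.2.2 ^ r / ((a : ℂ) * v.1 ^ p) ≠ 0 :=
      div_ne_zero (mul_ne_zero hc' (pow_ne_zero _ hz)) (mul_ne_zero ha' (pow_ne_zero _ hx))
    unfold kinf
    rw [if_neg this, inv_div]

theorem beta_one_sub {a b c : ℤ} {p q r : ℕ} (hc : c ≠ 0) (s : FermatSurface a b c p q r)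
    (hz : s.1.2.2 ≠ 0) :
    beta a c p r s.1 = ((1 - (b : ℂ) * s.1.2.1 ^ q / ((c : ℂ) * s.1.2.2 ^ r) : ℂ) : OnePoint ℂ) := by
  have hc' : (c : ℂ) ≠ 0 := by exact_mod_cast hc
  rw [beta_coe hc _ hz]
  congr 1
  have h := s.2.1
  have hd : (c : ℂ) * s.1.2.2 ^ r ≠ 0 := mul_ne_zero hc' (pow_ne_zero _ hz)
  rw [eq_sub_iff_add_eq, ← add_div, h, div_self hd]

theorem mem_badSet_iff {a b c : ℤ} {p q r : ℕ} (hp : p ≠ 0) (hq : q ≠ 0) (hr : r ≠ 0)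
    (ha : a ≠ 0) (hb : b ≠ 0) (hc : c ≠ 0) (s : FermatSurface a b c p q r) :
    beta a c p r s.1 ∈ badSetᶜ ↔ s.1.1 ≠ 0 ∧ s.1.2.1 ≠ 0 ∧ s.1.2.2 ≠ 0 := by
  have ha' : (a : ℂ) ≠ 0 := by exact_mod_cast ha
  have hb' : (b : ℂ) ≠ 0 := by exact_mod_cast hb
  have hc' : (c : ℂ) ≠ 0 := by exact_mod_cast hc
  constructor
  · intro h
    refine ⟨fun hx => h ?_, fun hy => h ?_, fun hz => h ?_⟩
    · by_cases hz : s.1.2.2 = 0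
      · rw [beta_infty hr _ hz]; exact Or.inr (Or.inr rfl)
      · rw [beta_coe hc _ hz, hx, zero_pow hp, mul_zero, zero_div]; exact Or.inl rfl
    · by_cases hz : s.1.2.2 = 0
      · rw [beta_infty hr _ hz]; exact Or.inr (Or.inr rfl)
      · rw [beta_one_sub hc _ hz, hy, zero_pow hq, mul_zero, zero_div, sub_zero]
        exact Or.inr (Or.inl rfl)
    · rw [beta_infty hr _ hz]; exact Or.inr (Or.inr rfl)
  · rintro ⟨hx, hy, hz⟩ (h | h | h)
    · rw [beta_coe hc _ hz] at h
      have := OnePoint.coe_injective h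
      exact div_ne_zero (mul_ne_zero ha' (pow_ne_zero _ hx)) (mul_ne_zero hc' (pow_ne_zero _ hz)) this
    · rw [beta_one_sub hc _ hz] at h
      have := OnePoint.coe_injective h
      rw [sub_eq_self] at this
      exact div_ne_zero (mul_ne_zero hb' (pow_ne_zero _ hy)) (mul_ne_zero hc' (pow_ne_zero _ hz)) this
    · rw [beta_coe hc _ hz] at h
      exact OnePoint.coe_ne_infty _ h

theorem beta_continuous {a b c : ℤ} {p q r : ℕ} (hp : p ≠ 0) (hq : q ≠ 0) (hr : r ≠ 0)
    (ha : a ≠ 0) (hb : b ≠ 0) (hc : c ≠ 0) :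
    Continuous fun s : FermatSurface a b c p q r => beta a c p r s.1 := by
  have ha' : (a : ℂ) ≠ 0 := by exact_mod_cast ha
  have hc' : (c : ℂ) ≠ 0 := by exact_mod_cast hc
  rw [continuous_iff_continuousAt]
  intro s
  by_cases hz : s.1.2.2 = 0
  · have hx : s.1.1 ≠ 0 := by
      rcases surface_cases hp hq hr ha hb hc s with h | h | h
      · exact (h.2 hz).elim
      · exact h.2.1
      · exact h.2.1
    have h1 : ContinuousAt (fun s : FermatSurface a b c p q r =>
        kinf ((c : ℂ) * s.1.2.2 ^ r / ((a : ℂ) * s.1.1 ^ p))) s := by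
      refine kinf_continuous.continuousAt.comp (ContinuousAt.div (by fun_prop) (by fun_prop) ?_)
      exact mul_ne_zero ha' (pow_ne_zero _ hx)
    refine h1.congr ?_
    have hcx : ContinuousAt (fun s : FermatSurface a b c p q r => s.1.1) s := by fun_prop
    filter_upwards [hcx.eventually_ne hx] with v hv
    exact (beta_kinf hr ha hc _ hv).symm
  · have h1 : ContinuousAt (fun s : FermatSurface a b c p q r =>
        (((a : ℂ) * s.1.1 ^ p / ((c : ℂ) * s.1.2.2 ^ r) : ℂ) : OnePoint ℂ)) s := by
      refine OnePoint.continuous_coe.continuousAt.comp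
        (ContinuousAt.div (by fun_prop) (by fun_prop) ?_)
      exact mul_ne_zero hc' (pow_ne_zero _ hz)
    refine h1.congr ?_
    have hcz : ContinuousAt (fun s : FermatSurface a b c p q r => s.1.2.2) s := by fun_prop
    filter_upwards [hcz.eventually_ne hz] with v hv
    exact (beta_coe hc _ hv).symm

theorem fermat_base {a b c : ℤ} {p q r : ℕ} (hp : p ≠ 0) (hq : q ≠ 0) (hr : r ≠ 0)
    (ha : a ≠ 0) (hb : b ≠ 0) (hc : c ≠ 0) (s : FermatSurface a b c p q r)
    (W : Set (FermatSurface a b c p q r)) (hW : W ∈ 𝓝 s) :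
    ∃ U ⊆ W, IsOpen U ∧ s ∈ U ∧
      IsConnected (U ∩ {s : FermatSurface a b c p q r | beta a c p r s.1 ∈ badSetᶜ}) := by
  have ha' : (a : ℂ) ≠ 0 := by exact_mod_cast ha
  have hb' : (b : ℂ) ≠ 0 := by exact_mod_cast hb
  have hbad : {s : FermatSurface a b c p q r | beta a c p r s.1 ∈ badSetᶜ} =
      {s | s.1.1 ≠ 0 ∧ s.1.2.1 ≠ 0 ∧ s.1.2.2 ≠ 0} :=
    Set.ext fun s => mem_badSet_iff hp hq hr ha hb hc s
  rw [hbad]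
  have hval : IsEmbedding (Subtype.val : FermatSurface a b c p q r → ℂ × ℂ × ℂ) :=
    IsEmbedding.subtypeVal
  rcases surface_cases hp hq hr ha hb hc s with h | h | h
  · obtain ⟨U, h1, h2, h3, h4⟩ := surface_base (X := FermatSurface a b c p q r)
      (fun s => s.1.1) (fun s => s.1.2.1) (fun s => s.1.2.2) hval a b (-c) hb' p q r hq
      (fun x => by linear_combination x.2.1)
      (fun u v w he hv => ⟨⟨(u, v, w), by
        simp only; linear_combination he, fun h0 => hv (by simp_all)⟩, rfl, rfl, rfl⟩)
      s h.1 h.2 W hW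
    exact ⟨U, h1, h2, h3, h4⟩
  · have hemb : IsEmbedding fun s : FermatSurface a b c p q r => (s.1.2.1, s.1.1, s.1.2.2) :=
      IsEmbedding.of_comp (g := fun v : ℂ × ℂ × ℂ => (v.2.1, v.1, v.2.2)) (by fun_prop)
        (by fun_prop) hval
    obtain ⟨U, h1, h2, h3, h4⟩ := surface_base (X := FermatSurface a b c p q r)
      (fun s => s.1.2.1) (fun s => s.1.1) (fun s => s.1.2.2) hemb b a (-c) ha' q p r hp
      (fun x => by linear_combination x.2.1)
      (fun u v w he hv => ⟨⟨(v, u, w), by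
        simp only; linear_combination he, fun h0 => hv (by simp_all)⟩, rfl, rfl, rfl⟩)
      s h.2.1 h.2.2 W hW
    refine ⟨U, h1, h2, h3, ?_⟩
    convert h4 using 2
    ext x
    exact and_left_comm
  · have hemb : IsEmbedding fun s : FermatSurface a b c p q r => (s.1.2.2, s.1.1, s.1.2.1) :=
      IsEmbedding.of_comp (g := fun v : ℂ × ℂ × ℂ => (v.2.1, v.2.2, v.1)) (by fun_prop)
        (by fun_prop) hval
    obtain ⟨U, h1, h2, h3, h4⟩ := surface_base (X := FermatSurface a b c p q r)
      (fun s => s.1.2.2) (fun s => s.1.1) (fun s => s.1.2.1) hemb (-c) a b ha' r p q hp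
      (fun x => by linear_combination x.2.1)
      (fun u v w he hv => ⟨⟨(v, w, u), by
        simp only; linear_combination he, fun h0 => hv (by simp_all)⟩, rfl, rfl, rfl⟩)
      s h.2.1 h.2.2 W hW
    refine ⟨U, h1, h2, h3, ?_⟩
    convert h4 using 2
    ext x
    show (_ ∧ _ ∧ _) ↔ (_ ∧ _ ∧ _)
    tauto

/-- Sections of the curve over a neighbourhood of every point of the surface. -/
theorem fermat_sections {a b c : ℤ} {p q r : ℕ} (hp : p ≠ 0) (hq : q ≠ 0) (hr : r ≠ 0)
    (ha : a ≠ 0) (hb : b ≠ 0) (hc : c ≠ 0)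
    (C : Type) [TopologicalSpace C] [CompactSpace C] [T2Space C]
    (π : C → OnePoint ℂ) (hπcont : Continuous π) (hπfib : ∀ x, (π ⁻¹' {x}).Finite)
    (hπcov : IsCoveringMapOn π badSetᶜ)
    (hram0 : ∀ γ, π γ = ((0 : ℂ) : OnePoint ℂ) →
      HasLocalPowerModel π γ ((0 : ℂ) : OnePoint ℂ) p)
    (hram1 : ∀ γ, π γ = ((1 : ℂ) : OnePoint ℂ) →
      HasLocalPowerModel π γ ((1 : ℂ) : OnePoint ℂ) q)
    (hramInf : ∀ γ, π γ = OnePoint.infty →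
      HasLocalPowerModel π γ OnePoint.infty r) (s : FermatSurface a b c p q r) :
    ∃ (N : Set (FermatSurface a b c p q r)) (I : Type) (_ : Finite I)
      (L : I → FermatSurface a b c p q r → C), IsOpen N ∧ s ∈ N ∧
      (∀ i, ContinuousOn (L i) N) ∧ (∀ i, ∀ x ∈ N, beta a c p r x.1 = π (L i x)) ∧
      (∀ x ∈ N, beta a c p r x.1 ∈ badSetᶜ →
        ∀ γ, π γ = beta a c p r x.1 → ∃! i, L i x = γ) := by
  have ha' : (a : ℂ) ≠ 0 := by exact_mod_cast ha
  have hb' : (b : ℂ) ≠ 0 := by exact_mod_cast hb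
  have hc' : (c : ℂ) ≠ 0 := by exact_mod_cast hc
  have hcx : Continuous fun s : FermatSurface a b c p q r => s.1.1 := by fun_prop
  have hcy : Continuous fun s : FermatSurface a b c p q r => s.1.2.1 := by fun_prop
  have hcz : Continuous fun s : FermatSurface a b c p q r => s.1.2.2 := by fun_prop
  by_cases hgood : beta a c p r s.1 ∈ badSetᶜ
  · obtain ⟨N, I, hI, L, h1, h2, h3, h4, h5⟩ := sections_good π
      (fun s : FermatSurface a b c p q r => beta a c p r s.1)
      (beta_continuous hp hq hr ha hb hc) s (hπfib _) (hπcov _ hgood)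
    exact ⟨N, I, hI, L, h1, h2, h3, h4, fun x hx _ => h5 x hx⟩
  · rw [mem_badSet_iff hp hq hr ha hb hc] at hgood
    rcases surface_cases hp hq hr ha hb hc s with h | h | h
    · have hx : s.1.1 = 0 := by
        by_contra hx
        exact hgood ⟨hx, h⟩
      obtain ⟨N₀, w, hsub, hN₀, hsN, hwc, hw⟩ := exists_local_root
        (fun s : FermatSurface a b c p q r => (a : ℂ) / (c * s.1.2.2 ^ r)) s {s | s.1.2.2 ≠ 0}
        (isOpen_ne.preimage hcz) h.2
        (continuousOn_const.div (by fun_prop) fun x hx => mul_ne_zero hc' (pow_ne_zero _ hx))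
        (div_ne_zero ha' (mul_ne_zero hc' (pow_ne_zero _ h.2))) p hp
      obtain ⟨N, I, hI, L, h1, h2, h3, h4, h5⟩ := sections_bad π hπcont _ (hπfib _) p hp hram0
        (fun u => (u : OnePoint ℂ)) OnePoint.continuous_coe OnePoint.coe_injective rfl
        (fun s : FermatSurface a b c p q r => beta a c p r s.1) s N₀ hN₀ hsN
        (fun x => x.1.1 * w x) (hcx.continuousOn.mul hwc) (by simp only [hx, zero_mul])
        (fun x hxN => by
          rw [beta_coe hc _ (hsub hxN), mul_pow, hw x hxN]
          congr 1; ring)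
      exact ⟨N, I, hI, L, h1, h2, h3, h4, fun x hx hg => h5 x hx fun h0 => hg (Or.inl h0)⟩
    · obtain ⟨N₀, w, hsub, hN₀, hsN, hwc, hw⟩ := exists_local_root
        (fun s : FermatSurface a b c p q r => (b : ℂ) / (c * s.1.2.2 ^ r)) s {s | s.1.2.2 ≠ 0}
        (isOpen_ne.preimage hcz) h.2.2
        (continuousOn_const.div (by fun_prop) fun x hx => mul_ne_zero hc' (pow_ne_zero _ hx))
        (div_ne_zero hb' (mul_ne_zero hc' (pow_ne_zero _ h.2.2))) q hq
      obtain ⟨N, I, hI, L, h1, h2, h3, h4, h5⟩ := sections_bad π hπcont _ (hπfib _) q hq hram1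
        (fun u => ((1 - u : ℂ) : OnePoint ℂ)) (OnePoint.continuous_coe.comp (by fun_prop))
        (OnePoint.coe_injective.comp sub_right_injective) (by simp only [sub_zero])
        (fun s : FermatSurface a b c p q r => beta a c p r s.1) s N₀ hN₀ hsN
        (fun x => x.1.2.1 * w x) (hcy.continuousOn.mul hwc) (by simp only [h.1, zero_mul])
        (fun x hxN => by
          rw [beta_one_sub hc _ (hsub hxN), mul_pow, hw x hxN]
          congr 1; ring)
      exact ⟨N, I, hI, L, h1, h2, h3, h4, fun x hx hg => h5 x hx fun h0 => hg (Or.inr (Or.inl h0))⟩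
    · obtain ⟨N₀, w, hsub, hN₀, hsN, hwc, hw⟩ := exists_local_root
        (fun s : FermatSurface a b c p q r => (c : ℂ) / (a * s.1.1 ^ p)) s {s | s.1.1 ≠ 0}
        (isOpen_ne.preimage hcx) h.2.1
        (continuousOn_const.div (by fun_prop) fun x hx => mul_ne_zero ha' (pow_ne_zero _ hx))
        (div_ne_zero hc' (mul_ne_zero ha' (pow_ne_zero _ h.2.1))) r hr
      obtain ⟨N, I, hI, L, h1, h2, h3, h4, h5⟩ := sections_bad π hπcont _ (hπfib _) r hr hramInf
        kinf kinf_continuous kinf_injective (if_pos rfl)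
        (fun s : FermatSurface a b c p q r => beta a c p r s.1) s N₀ hN₀ hsN
        (fun x => x.1.2.2 * w x) (hcz.continuousOn.mul hwc) (by simp only [h.1, zero_mul])
        (fun x hxN => by
          rw [beta_kinf hr ha hc _ (hsub hxN), mul_pow, hw x hxN]
          congr 1; ring)
      exact ⟨N, I, hI, L, h1, h2, h3, h4, fun x hx hg => h5 x hx fun h0 => hg (Or.inr (Or.inr h0))⟩

end Helpers

/-- let `(p, q, r)` be positive integers with `1/p + 1/q + 1/r < 1` and
`a, b, c` nonzero integers.  Let `S` be the Fermat surface minus the origin,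
`β : S → ℙ¹` as above, `π : C → ℙ¹` a finite cover by a smooth projective curve ramified
precisely over `{0, 1, ∞}` with ramification orders `p, q, r`, and let `F` (with
normalization map `ν`) be the normalization of the fiber product `S ×_{ℙ¹} C`, with
`π̄ = pr_S ∘ ν : F → S` the induced finite dominant map.  Then
`π̄_ℂ : F(ℂ) → S(ℂ)` is an unramified topological cover (a surjective covering map for
the Euclidean topologies). -/
theorem normalized_fiber_product_isCoveringMap
    (p q r : ℕ) (hp : 0 < p) (hq : 0 < q) (hr : 0 < r)
    (hhyp : (1 : ℚ) / p + 1 / q + 1 / r < 1)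
    (a b c : ℤ) (ha : a ≠ 0) (hb : b ≠ 0) (hc : c ≠ 0)
    -- the curve `C`, topological model of a smooth projective curve:
    (C : Type) [TopologicalSpace C] [CompactSpace C] [T2Space C] [ConnectedSpace C]
    (π : C → OnePoint ℂ) (hπcont : Continuous π) (hπsurj : Function.Surjective π)
    (hπfib : ∀ x, (π ⁻¹' {x}).Finite)
    -- `π` is a covering away from `{0,1,∞}` and ramifies with orders `p, q, r` there:
    (hπcov : IsCoveringMapOn π badSetᶜ)
    (hram0 : ∀ γ, π γ = ((0 : ℂ) : OnePoint ℂ) →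
      HasLocalPowerModel π γ ((0 : ℂ) : OnePoint ℂ) p)
    (hram1 : ∀ γ, π γ = ((1 : ℂ) : OnePoint ℂ) →
      HasLocalPowerModel π γ ((1 : ℂ) : OnePoint ℂ) q)
    (hramInf : ∀ γ, π γ = OnePoint.infty →
      HasLocalPowerModel π γ OnePoint.infty r)
    -- the normalization `F` of the fiber product `S ×_{ℙ¹} C`:
    (F : Type) [TopologicalSpace F] [T2Space F] [LocallyCompactSpace F]
    (ν : F → fiberProd a b c p q r π)
    (hνcont : Continuous ν) (hνsurj : Function.Surjective ν)
    (hνproper : IsProperMap ν) (hνfin : ∀ z, (ν ⁻¹' {z}).Finite)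
    -- `ν` is a homeomorphism over the good locus, which is dense upstairs:
    (hνinj : Set.InjOn ν (ν ⁻¹' goodLocus a b c p q r π))
    (hνdense : Dense (ν ⁻¹' goodLocus a b c p q r π))
    -- normality: connected local branches along the good locus:
    (hνbranch : ∀ x : F, ∀ W ∈ nhds x, ∃ U ⊆ W, IsOpen U ∧ x ∈ U ∧
      IsConnected (U ∩ ν ⁻¹' goodLocus a b c p q r π)) :
    Function.Surjective
        (fun f : F => ((ν f : FermatSurface a b c p q r × C)).1) ∧
      IsCoveringMap (fun f : F => ((ν f : FermatSurface a b c p q r × C)).1) := by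
  have hp' := hp.ne'
  have hq' := hq.ne'
  have hr' := hr.ne'
  have hβc := beta_continuous (p := p) (q := q) (r := r) hp' hq' hr' ha hb hc
  have hmem : ∀ f : F, beta a c p r ((ν f).1.1 : ℂ × ℂ × ℂ) = π (ν f).1.2 := fun f => (ν f).2
  refine ⟨?_, ?_⟩
  · intro s
    obtain ⟨γ, hγ⟩ := hπsurj (beta a c p r s.1)
    obtain ⟨f, hf⟩ := hνsurj ⟨(s, γ), hγ.symm⟩
    exact ⟨f, by simp only [hf]⟩
  · have hclosed : IsClosed (fiberProd a b c p q r π) :=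
      isClosed_eq (hβc.comp continuous_fst) (hπcont.comp continuous_snd)
    have hproper : IsProperMap
        (fun f : F => ((ν f : FermatSurface a b c p q r × C)).1) :=
      (isProperMap_fst_of_compactSpace.comp hclosed.isClosedEmbedding_subtypeVal.isProperMap).comp
        hνproper
    have hgl : ν ⁻¹' goodLocus a b c p q r π =
        (fun f : F => ((ν f : FermatSurface a b c p q r × C)).1) ⁻¹'
          {s : FermatSurface a b c p q r | beta a c p r s.1 ∈ badSetᶜ} := by
      ext f
      show π (ν f).1.2 ∈ badSetᶜ ↔ beta a c p r ((ν f).1.1 : ℂ × ℂ × ℂ) ∈ badSetᶜ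
      rw [hmem]
    rw [hgl] at hνinj hνbranch
    intro s
    obtain ⟨N, I, hI, L, hN, hsN, hL, hLβ, hLu⟩ := fermat_sections hp' hq' hr' ha hb hc C π hπcont
      hπfib hπcov hram0 hram1 hramInf s
    refine evenly_covered_of_sections _ (fun f : F => (ν f).1.2)
      (fun s : FermatSurface a b c p q r => beta a c p r s.1) π
      {s : FermatSurface a b c p q r | beta a c p r s.1 ∈ badSetᶜ} hproper
      (continuous_snd.comp (continuous_subtype_val.comp hνcont)) ?_ hmem ?_ ?_ hνbranch
      (fermat_base hp' hq' hr' ha hb hc) s N hN hsN I L hL hLβ hLu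
    · intro x
      have hfib : (⋃ γ ∈ π ⁻¹' {beta a c p r x.1}, {f : F | (ν f).1 = (x, γ)}).Finite := by
        refine (hπfib _).biUnion fun γ hγ => ?_
        refine (hνfin ⟨(x, γ), (show π γ = _ from hγ).symm⟩).subset fun f hf => Subtype.ext hf
      refine hfib.subset fun f hf => ?_
      have hf : (ν f).1.1 = x := hf
      refine Set.mem_biUnion (x := (ν f).1.2) ?_ ?_
      · show π (ν f).1.2 = beta a c p r x.1
        rw [← hmem, hf]
      · exact Prod.ext hf rfl
    · intro f f' hG h1 h2
      refine hνinj hG ?_ (Subtype.ext (Prod.ext h1 h2))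
      show beta a c p r ((ν f').1.1 : ℂ × ℂ × ℂ) ∈ badSetᶜ
      have h1 : (ν f).1.1 = (ν f').1.1 := h1
      rw [← h1]; exact hG
    · intro x γ h
      obtain ⟨f, hf⟩ := hνsurj ⟨(x, γ), h⟩
      exact ⟨f, by simp only [hf], by simp only [hf]⟩

end DarmonGranville
end
end

section
/- Let π : W → V be a finite dominant morphism of complex quasi-projective varieties with V normal. If the induced map π : W(ℂ) → V(ℂ) on complex points (Euclidean topology) is a topological cover, then the morphism π is étale. -/
/- STATEMENT 15.  Since étaleness is a local property and a quasi-projective variety is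
covered by affine charts (on which a finite morphism is given by a module-finite map of
coordinate rings), the statement is formalized for affine complex varieties, presented
by their coordinate rings: `V = Spec (ℂ[y₁,…,y_r]/J)` (the base, assumed normal, i.e.
its coordinate ring is an integrally closed domain), `W = Spec (ℂ[x₁,…,x_s]/I)`, and
`π : W → V` given by polynomials `p₁, …, p_r` (so that `y_i ↦ p_i` induces the map
`A = ℂ[y]/J → B = ℂ[x]/I` on coordinate rings).  The ideals are radical, so that the
coordinate rings faithfully correspond to the sets of complex points. -/

noncomputable section
namespace EtaleFromCover

open MvPolynomial

/-- The set of complex points of the affine variety cut out by the ideal `J`, with its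
Euclidean (subspace) topology. -/
def points {N : ℕ} (J : Ideal (MvPolynomial (Fin N) ℂ)) : Set (Fin N → ℂ) :=
  {v | ∀ Q ∈ J, MvPolynomial.aeval v Q = 0}

/-- The ring map `A = ℂ[y]/J → B = ℂ[x]/I` on coordinate rings induced by the
polynomial map `π = (p₁, …, p_r) : W → V`. -/
def inducedRingHom {r s : ℕ}
    (I : Ideal (MvPolynomial (Fin s) ℂ)) (J : Ideal (MvPolynomial (Fin r) ℂ))
    (p : Fin r → MvPolynomial (Fin s) ℂ)
    (hmap : ∀ Q ∈ J, MvPolynomial.aeval p Q ∈ I) :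
    (MvPolynomial (Fin r) ℂ ⧸ J) →+* (MvPolynomial (Fin s) ℂ ⧸ I) :=
  Ideal.Quotient.lift J ((Ideal.Quotient.mk I).comp (MvPolynomial.aeval p).toRingHom)
    (fun q hq => by
      simp only [RingHom.comp_apply, AlgHom.toRingHom_eq_coe, RingHom.coe_coe]
      exact Ideal.Quotient.eq_zero_iff_mem.mpr (hmap q hq))

/-- The induced map `π : W(ℂ) → V(ℂ)` on complex points, `v ↦ (p₁(v), …, p_r(v))`. -/
def pointsMap {r s : ℕ}
    (I : Ideal (MvPolynomial (Fin s) ℂ)) (J : Ideal (MvPolynomial (Fin r) ℂ))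
    (p : Fin r → MvPolynomial (Fin s) ℂ)
    (hmap : ∀ Q ∈ J, MvPolynomial.aeval p Q ∈ I)
    (v : points I) : points J :=
  ⟨fun i => MvPolynomial.aeval (v : Fin s → ℂ) (p i), fun Q hQ => by
    rw [← MvPolynomial.comp_aeval_apply]
    exact v.2 _ (hmap Q hQ)⟩

end EtaleFromCover
end

section
open Polynomial

theorem exists_separating {k E M ι : Type*} [Field k] [Infinite k] [AddCommGroup E] [Module k E]
    [AddCommGroup M] [Module k M] [Finite ι] (f : ι → E →ₗ[k] M) (hf : Function.Injective f) :
    ∃ e, Function.Injective (fun i => f i e) := by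
  by_contra! h
  have := Subspace.exists_eq_top_of_iUnion_eq_univ (k := k) (E := E)
    (ι := {x : ι × ι // x.1 ≠ x.2})
    (p := fun x => LinearMap.ker (f x.1.1 - f x.1.2)) (by
      rw [Set.eq_univ_iff_forall]
      intro e
      have := h e
      simp only [Function.Injective, not_forall] at this
      obtain ⟨i, j, hij, hne⟩ := this
      rw [Set.mem_iUnion]
      exact ⟨⟨(i, j), hne⟩, by simp [hij]⟩)
  obtain ⟨⟨⟨i, j⟩, hne⟩, hx⟩ := this
  rw [LinearMap.ker_eq_top, sub_eq_zero] at hx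
  exact hne (hf hx)

theorem exists_point_lift {R S : Type*} [CommRing R] [CommRing S] [Algebra ℂ R] [Algebra ℂ S]
    [Algebra R S] [IsScalarTower ℂ R S] (hinj : Function.Injective (algebraMap R S))
    [Algebra.IsIntegral R S] (χ : R →ₐ[ℂ] ℂ) :
    ∃ ψ : S →ₐ[ℂ] ℂ, ∀ r, ψ (algebraMap R S r) = χ r := by
  have hmax : (RingHom.ker χ).IsMaximal :=
    RingHom.ker_isMaximal_of_surjective χ (fun z => ⟨algebraMap ℂ R z, by simp⟩)
  obtain ⟨Q, hQ, hQ'⟩ := Ideal.exists_ideal_over_maximal_of_isIntegral (S := S) (RingHom.ker χ) (by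
    rw [(RingHom.injective_iff_ker_eq_bot _).1 hinj]; exact bot_le)
  have hker : ∀ r, algebraMap R S r - algebraMap ℂ S (χ r) ∈ Q := by
    intro r
    have : r - algebraMap ℂ R (χ r) ∈ RingHom.ker χ := by simp [RingHom.mem_ker]
    rw [← hQ', Ideal.mem_comap] at this
    rwa [map_sub, ← IsScalarTower.algebraMap_apply] at this
  let : Field (S ⧸ Q) := Ideal.Quotient.field Q
  have : Algebra.IsIntegral ℂ (S ⧸ Q) := ⟨fun x => by
    obtain ⟨s, rfl⟩ := Ideal.Quotient.mk_surjective x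
    obtain ⟨G, hG, hG0⟩ := Algebra.IsIntegral.isIntegral (R := R) s
    refine ⟨G.map χ.toRingHom, hG.map _, ?_⟩
    have h1 : (Ideal.Quotient.mk Q).comp (algebraMap R S) =
        (algebraMap ℂ (S ⧸ Q)).comp χ.toRingHom := by
      ext r
      have := hker r
      rw [← Ideal.Quotient.eq] at this
      simpa using this
    rw [eval₂_map, ← h1, ← hom_eval₂, hG0, map_zero]⟩
  let φ : (S ⧸ Q) →ₐ[ℂ] ℂ := IsAlgClosed.lift
  refine ⟨φ.comp (Ideal.Quotient.mkₐ ℂ Q), fun r => ?_⟩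
  have := hker r
  rw [← Ideal.Quotient.eq] at this
  simp only [AlgHom.comp_apply, Ideal.Quotient.mkₐ_eq_mk, this]
  exact φ.commutes (χ r)

theorem exists_point_root {R S : Type*} [CommRing R] [CommRing S] [Algebra ℂ R] [Algebra ℂ S]
    [Algebra R S] [IsScalarTower ℂ R S] [Algebra.IsIntegral R S] (χ : R →ₐ[ℂ] ℂ)
    (b : S) (F : R[X]) (h0 : aeval b F = 0) (hF : ∀ G : R[X], aeval b G = 0 → F ∣ G)
    (z : ℂ) (hz : (F.map χ.toRingHom).eval z = 0) :
    ∃ ψ : S →ₐ[ℂ] ℂ, (∀ r, ψ (algebraMap R S r) = χ r) ∧ ψ b = z := by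
  let T := AdjoinRoot F
  let j : T →ₐ[R] S := AdjoinRoot.liftAlgHom F (Algebra.ofId R S) b h0
  have hj : Function.Injective j := by
    rw [injective_iff_map_eq_zero]
    intro x hx
    obtain ⟨G, rfl⟩ := AdjoinRoot.mk_surjective x
    rw [AdjoinRoot.mk_eq_zero]
    apply hF
    have : j (AdjoinRoot.mk F G) = aeval b G := by
      simp [j]; rfl
    rw [← this, hx]
  let : Algebra T S := j.toRingHom.toAlgebra
  have : IsScalarTower R T S := IsScalarTower.of_algebraMap_eq' j.comp_algebraMap.symm
  have : IsScalarTower ℂ T S := IsScalarTower.of_algebraMap_eq (fun z => by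
    rw [IsScalarTower.algebraMap_apply ℂ R S, IsScalarTower.algebraMap_apply ℂ R T]
    exact (j.commutes _).symm)
  have : Algebra.IsIntegral T S := Algebra.IsIntegral.tower_top R
  let χT : T →ₐ[ℂ] ℂ := AdjoinRoot.liftAlgHom F χ z (by
    rw [← eval_map]; exact hz)
  obtain ⟨ψ, hψ⟩ := exists_point_lift (R := T) (S := S) hj χT
  refine ⟨ψ, fun r => ?_, ?_⟩
  · rw [IsScalarTower.algebraMap_apply R T S, hψ]
    exact AdjoinRoot.liftAlgHom_of ..
  · have := hψ (AdjoinRoot.root F)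
    rw [show algebraMap T S (AdjoinRoot.root F) = b from AdjoinRoot.liftAlgHom_root ..] at this
    rw [this]
    exact AdjoinRoot.liftAlgHom_root ..

/-- the fibre of points over a point of the base -/
def PtFib {R S : Type*} [CommRing R] [CommRing S] [Algebra ℂ R] [Algebra ℂ S]
    [Algebra R S] (χ : R →ₐ[ℂ] ℂ) : Type _ :=
  {ψ : S →ₐ[ℂ] ℂ // ∀ r, ψ (algebraMap R S r) = χ r}

theorem ptFib_finite {R S : Type*} [CommRing R] [CommRing S] [Algebra ℂ R] [Algebra ℂ S]
    [Algebra R S] [IsScalarTower ℂ R S] [Module.Finite R S] (χ : R →ₐ[ℂ] ℂ) :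
    Finite (PtFib (S := S) χ) := by
  let : Algebra R ℂ := χ.toRingHom.toAlgebra
  let e : PtFib (S := S) χ → (TensorProduct R ℂ S →ₐ[ℂ] ℂ) := fun ψ =>
    Algebra.TensorProduct.lift (Algebra.ofId ℂ ℂ)
      ({ ψ.1.toRingHom with commutes' := ψ.2 } : S →ₐ[R] ℂ) (fun _ _ => mul_comm _ _)
  refine Finite.of_injective e (fun ψ ψ' h => ?_)
  apply Subtype.ext
  ext s
  have := congrArg (fun f => f (1 ⊗ₜ s)) h
  simpa [e] using this

theorem exists_good_poly (R K S T : Type*) [CommRing R] [IsDomain R] [IsIntegrallyClosed R]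
    [Field K] [Algebra R K] [IsFractionRing R K] [CommRing S] [Algebra R S]
    [Algebra.IsIntegral R S] [CommRing T] [Algebra R T] [Algebra K T] [Algebra S T]
    [IsScalarTower R K T] [IsScalarTower R S T] (hinj : Function.Injective (algebraMap S T))
    (b : S) : ∃ F : R[X], F.Monic ∧ aeval b F = 0 ∧ (∀ G : R[X], aeval b G = 0 → F ∣ G) ∧
      F.map (algebraMap R K) = minpoly K (algebraMap S T b) := by
  obtain ⟨G, hG, hG0⟩ := Algebra.IsIntegral.isIntegral (R := R) b
  have key : ∀ H : R[X], aeval (algebraMap S T b) (H.map (algebraMap R K)) =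
      algebraMap S T (aeval b H) := by
    intro H
    rw [aeval_map_algebraMap, aeval_algebraMap_apply]
  have hTint : IsIntegral K (algebraMap S T b) := ⟨G.map (algebraMap R K), hG.map _, by
    have := key G
    rw [aeval_def, aeval_def] at this
    rw [this, hG0, map_zero]⟩
  have hdvd : ∀ H : R[X], aeval b H = 0 →
      minpoly K (algebraMap S T b) ∣ H.map (algebraMap R K) := by
    intro H hH
    apply minpoly.dvd
    rw [key, hH, map_zero]
  obtain ⟨F, hF⟩ := IsIntegrallyClosed.eq_map_mul_C_of_dvd K hG (hdvd G hG0)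
  rw [(minpoly.monic hTint).leadingCoeff, C_1, mul_one] at hF
  have hmon : F.Monic := by
    apply Polynomial.monic_of_injective (IsFractionRing.injective R K)
    rw [hF]; exact minpoly.monic hTint
  refine ⟨F, hmon, ?_, ?_, hF⟩
  · apply hinj
    rw [← key, hF, minpoly.aeval, map_zero]
  · intro H hH
    have := hdvd H hH
    rw [← hF] at this
    exact (Polynomial.map_dvd_map _ (IsFractionRing.injective R K) hmon).1 this

end

section
open Polynomial TensorProduct

theorem exists_primitive (K T S : Type) [Field K] [CharZero K] [CommRing T] [Algebra K T]
    [Module.Finite K T] [IsReduced T] [CommRing S] [Algebra ℂ S] [Algebra ℂ K] [Algebra ℂ T]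
    [IsScalarTower ℂ K T] [Algebra S T] [IsScalarTower ℂ S T]
    (hspan : Submodule.span K (Set.range (algebraMap S T)) = ⊤) :
    ∃ c : S, Module.finrank K T ≤ (minpoly K (algebraMap S T c)).natDegree := by
  classical
  let L := AlgebraicClosure K
  have : IsArtinianRing T := isArtinian_of_tower K inferInstance
  have : Algebra.FormallyEtale K T := by
    let _ (m : MaximalSpectrum T) : Field (T ⧸ m.asIdeal) := Ideal.Quotient.field m.asIdeal
    rw [Algebra.FormallyEtale.iff_of_equiv ((IsArtinianRing.equivPi T).restrictScalars K),
      Algebra.FormallyEtale.pi_iff]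
    intro m
    exact Algebra.FormallyEtale.of_isSeparable _ _
  let e := Algebra.FormallyEtale.equivPiOfIsSepClosed L (L ⊗[K] T)
  have : IsArtinianRing (L ⊗[K] T) := isArtinian_of_tower L inferInstance
  have : Fintype (PrimeSpectrum (L ⊗[K] T)) := Fintype.ofFinite _
  have hcard : Fintype.card (PrimeSpectrum (L ⊗[K] T)) = Module.finrank K T := by
    rw [← Module.finrank_baseChange (R := L), e.toLinearEquiv.finrank_eq, Module.finrank_pi]
  let f (p : PrimeSpectrum (L ⊗[K] T)) : T →ₐ[K] L :=
    ((Pi.evalAlgHom L (fun _ => L) p).restrictScalars K).comp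
      ((e.toAlgHom.restrictScalars K).comp Algebra.TensorProduct.includeRight)
  have hf : ∀ p t, f p t = e (1 ⊗ₜ t) p := fun p t => rfl
  let g (p : PrimeSpectrum (L ⊗[K] T)) : S →ₗ[ℂ] L :=
    ((f p).restrictScalars ℂ).toLinearMap ∘ₗ (IsScalarTower.toAlgHom ℂ S T).toLinearMap
  have hg : ∀ p s, g p s = f p (algebraMap S T s) := fun p s => rfl
  have hginj : Function.Injective g := by
    intro p q hpq
    have h1 : (f p).toLinearMap = (f q).toLinearMap := by
      apply LinearMap.ext_on_range hspan
      intro s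
      exact DFunLike.congr_fun hpq s
    have h2 : ∀ x : L ⊗[K] T, e x p = e x q := by
      intro x
      induction x with
      | zero => simp
      | add x y hx hy => simp [hx, hy]
      | tmul l t =>
        have h3 : (l ⊗ₜ t : L ⊗[K] T) = l • (1 ⊗ₜ t) := by simp [smul_tmul']
        rw [h3, map_smul, Pi.smul_apply, Pi.smul_apply, ← hf, ← hf]
        congr 1
        exact DFunLike.congr_fun h1 t
    by_contra hne
    obtain ⟨x, hx⟩ := e.surjective (Pi.single p 1)
    have := h2 x
    rw [hx, Pi.single_eq_same, Pi.single_eq_of_ne (Ne.symm hne)] at this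
    exact one_ne_zero this
  obtain ⟨c, hc⟩ := exists_separating g hginj
  refine ⟨c, ?_⟩
  set m := minpoly K (algebraMap S T c) with hm
  have hmm : m.Monic := minpoly.monic (Algebra.IsIntegral.isIntegral _)
  have hle : (Finset.univ.image (fun p => g p c)).card ≤ (m.map (algebraMap K L)).natDegree := by
    apply Polynomial.card_le_degree_of_subset_roots
    intro z hz
    simp only [Finset.image_val, Multiset.mem_dedup, Multiset.mem_map, Finset.mem_val,
      Finset.mem_univ, true_and] at hz
    obtain ⟨p, rfl⟩ := hz
    rw [mem_roots (hmm.map _).ne_zero, IsRoot, eval_map_algebraMap, hg, aeval_algHom_apply,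
      minpoly.aeval, map_zero]
  rwa [Finset.card_image_of_injective _ hc, Finset.card_univ, hcard, natDegree_map] at hle


end

section
open Polynomial TensorProduct

theorem etale_away_of_conductor {A B : Type} [CommRing A] [CommRing B] [Algebra A B]
    (b : B) (F : A[X]) (hmon : F.Monic) (h0 : aeval b F = 0)
    (hF : ∀ G : A[X], aeval b G = 0 → F ∣ G)
    (hcond : ∀ y : B, ∃ g : A[X], aeval b (derivative F) * y = aeval b g) :
    Algebra.Etale A (Localization.Away (aeval b (derivative F))) := by
  let P : StandardEtalePair A := ⟨F, hmon, derivative F, 1, 0, 1, by simp⟩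
  set Bg := Localization.Away (aeval b (derivative F)) with hBg
  have hu : IsUnit (algebraMap B Bg (aeval b (derivative F))) :=
    IsLocalization.Away.algebraMap_isUnit _
  have hmap : P.HasMap (algebraMap B Bg b) := by
    refine ⟨?_, ?_⟩
    · rw [aeval_algebraMap_apply]
      simp [P, h0]
    · rw [aeval_algebraMap_apply]
      exact hu
  let φ := P.lift _ hmap
  have hφX : φ P.X = algebraMap B Bg b := P.lift_X _ hmap
  have hφ : ∀ G : A[X], φ (aeval P.X G) = algebraMap B Bg (aeval b G) := by
    intro G
    rw [← aeval_algHom_apply, hφX, aeval_algebraMap_apply]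
  have hP : ∀ x : P.Ring, ∃ (G : A[X]) (n : ℕ), x * aeval P.X (derivative F) ^ n = aeval P.X G := by
    intro x
    let Q : StandardEtalePresentation A P.Ring := ⟨P, P.X, P.hasMap_X, by
      rw [P.lift_X_left]; exact Function.bijective_id⟩
    obtain ⟨G, n, h⟩ := Q.exists_mul_aeval_x_g_pow_eq_aeval_x x
    exact ⟨G, n, h⟩
  have hbij : Function.Bijective φ := by
    constructor
    · rw [injective_iff_map_eq_zero]
      intro x hx
      obtain ⟨G, n, h⟩ := hP x
      have h1 : algebraMap B Bg (aeval b G) = 0 := by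
        rw [← hφ, ← h, map_mul, hx, zero_mul]
      rw [IsLocalization.map_eq_zero_iff (Submonoid.powers (aeval b (derivative F)))] at h1
      obtain ⟨⟨_, k, rfl⟩, hk⟩ := h1
      have h2 : F ∣ derivative F ^ k * G := hF _ (by rw [map_mul, map_pow]; exact hk)
      have h3 : aeval P.X (derivative F ^ k * G) = 0 := by
        obtain ⟨H, hH⟩ := h2
        rw [hH, map_mul, show aeval P.X F = 0 from P.hasMap_X.1, zero_mul]
      have h4 : IsUnit (aeval P.X (derivative F)) := P.hasMap_X.2
      rw [map_mul, map_pow, (h4.pow k).mul_right_eq_zero, ← h, (h4.pow n).mul_left_eq_zero] at h3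
      exact h3
    · intro y
      obtain ⟨⟨x, ⟨_, n, rfl⟩⟩, hx⟩ := IsLocalization.surj
        (Submonoid.powers (aeval b (derivative F))) y
      obtain ⟨g, hg⟩ := hcond x
      obtain ⟨u, hu'⟩ : IsUnit (aeval P.X (derivative F)) := P.hasMap_X.2
      refine ⟨aeval P.X g * (↑u⁻¹ : P.Ring) ^ (n + 1), ?_⟩
      apply (hu.pow (n+1)).mul_left_injective
      have h5 : φ (↑u⁻¹ : P.Ring) * algebraMap B Bg (aeval b (derivative F)) = 1 := by
        rw [← hφ, ← hu', ← map_mul, Units.inv_mul, map_one]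
      simp only [map_mul, map_pow] at hx ⊢
      rw [mul_assoc, ← mul_pow, h5, one_pow, mul_one, hφ, ← hg, pow_succ, ← mul_assoc, hx, map_mul,
        mul_comm]
  exact Algebra.Etale.of_equiv (AlgEquiv.ofBijective φ hbij)

theorem conductor_of_degree (A K B T : Type) [CommRing A] [IsDomain A] [IsIntegrallyClosed A]
    [Field K] [Algebra A K] [IsFractionRing A K] [CommRing B] [Algebra A B]
    [Algebra.IsIntegral A B] [CommRing T] [Algebra A T] [Algebra K T] [Algebra B T]
    [IsScalarTower A K T] [IsScalarTower A B T] [Module.Finite K T]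
    (hinj : Function.Injective (algebraMap B T))
    (b : B) (F : A[X]) (hmon : F.Monic)
    (hF : F.map (algebraMap A K) = minpoly K (algebraMap B T b))
    (hdeg : F.natDegree = Module.finrank K T) (y : B) :
    ∃ g : A[X], aeval b (derivative F) * y = aeval b g := by
  set bT := algebraMap B T b
  have hdeg' : (minpoly K bT).natDegree = Module.finrank K T := by
    rw [← hF, hmon.natDegree_map, hdeg]
  have hne : minpoly K bT ≠ 0 := minpoly.ne_zero (Algebra.IsIntegral.isIntegral _)
  have hsurj : Function.Surjective (aeval (R := K) bT) := by
    let j : AdjoinRoot (minpoly K bT) →ₐ[K] T :=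
      AdjoinRoot.liftAlgHom _ (Algebra.ofId K T) bT (minpoly.aeval K bT)
    have hj' : ∀ G, j (AdjoinRoot.mk _ G) = aeval bT G := fun G => by simp [j]; rfl
    have hj : Function.Injective j := by
      rw [injective_iff_map_eq_zero]
      intro x hx
      obtain ⟨G, rfl⟩ := AdjoinRoot.mk_surjective x
      rw [AdjoinRoot.mk_eq_zero]
      apply minpoly.dvd
      rw [← hj', hx]
    have := (AdjoinRoot.powerBasis hne).finite
    have hs : Function.Surjective j.toLinearMap := by
      rw [← LinearMap.injective_iff_surjective_of_finrank_eq_finrank]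
      · exact hj
      · rw [(AdjoinRoot.powerBasis hne).finrank, AdjoinRoot.powerBasis_dim, hdeg']
    intro t
    obtain ⟨x, hx⟩ := hs t
    obtain ⟨G, rfl⟩ := AdjoinRoot.mk_surjective x
    exact ⟨G, by rw [← hj', ← hx]; rfl⟩
  obtain ⟨g, hg, hgi⟩ := exists_derivative_mul_eq_and_isIntegral_coeff (R := A) (S := K) (B := T)
    (φ := (aeval (R := K) bT).restrictScalars A) hsurj (f := F.map (algebraMap A K)) (hmon.map _)
    (fun i => by rw [coeff_map]; exact isIntegral_algebraMap)
    (by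
      rw [hF]
      exact (minpoly.ker_aeval_eq_span_minpoly K bT))
    (y := algebraMap B T y) ((Algebra.IsIntegral.isIntegral (R := A) y).algebraMap)
  have hlift : g ∈ Polynomial.lifts (algebraMap A K) := by
    rw [Polynomial.lifts_iff_coeff_lifts]
    intro i
    exact IsIntegrallyClosed.isIntegral_iff.1 (hgi i)
  obtain ⟨g', rfl⟩ := hlift
  refine ⟨g', hinj ?_⟩
  rw [map_mul, ← aeval_algebraMap_apply, ← aeval_algebraMap_apply]
  rw [derivative_map] at hg
  simpa using hg

end

section
open Polynomial TensorProduct nonZeroDivisors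

theorem core_etale (A B : Type) [CommRing A] [CommRing B] [Algebra ℂ A] [Algebra ℂ B] [Algebra A B]
    [IsScalarTower ℂ A B] [IsDomain A] [IsIntegrallyClosed A] [Module.Finite A B] [IsReduced B]
    [IsNoetherianRing A] [Algebra.FiniteType ℂ B]
    (htf : ∀ (a : A) (b : B), a ≠ 0 → algebraMap A B a * b = 0 → b = 0)
    (hfib : ∀ (χ₀ : A →ₐ[ℂ] ℂ) (f : A), f ≠ 0 → ∃ χ : A →ₐ[ℂ] ℂ, χ f ≠ 0 ∧
      Nat.card (PtFib (S := B) χ) = Nat.card (PtFib (S := B) χ₀)) :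
    Algebra.Etale A B := by
  classical
  let K := FractionRing A
  let T := Localization (Algebra.algebraMapSubmonoid B A⁰)
  let : Algebra K T := localizationAlgebra A⁰ B
  have : IsScalarTower A K T := inferInstance
  have : IsScalarTower A B T := inferInstance
  have : Module.Finite K T := Module.Finite.of_isLocalization A B A⁰
  have : IsScalarTower ℂ A K := inferInstance
  have : IsScalarTower ℂ A T := inferInstance
  have : IsScalarTower ℂ B T := inferInstance
  have : IsScalarTower ℂ K T := IsScalarTower.to₁₃₄ ℂ A K T
  have : CharZero K := charZero_of_injective_algebraMap (algebraMap ℂ K).injective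
  have : IsReduced T := inferInstance
  have hinj : Function.Injective (algebraMap B T) := by
    apply IsLocalization.injective (M := Algebra.algebraMapSubmonoid B A⁰)
    rintro _ ⟨a, ha, rfl⟩
    rw [mem_nonZeroDivisors_iff_right]
    intro x hx
    exact htf a x (nonZeroDivisors.ne_zero ha) (by rw [mul_comm]; exact hx)
  have hspan : Submodule.span K (Set.range (algebraMap B T)) = ⊤ := by
    rw [eq_top_iff]
    rintro t -
    obtain ⟨⟨x, ⟨_, a, ha, rfl⟩⟩, hx⟩ := IsLocalization.surj (Algebra.algebraMapSubmonoid B A⁰) t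
    have ha0 : algebraMap A K a ≠ 0 := by
      simpa using nonZeroDivisors.ne_zero ha
    have : t = (algebraMap A K a)⁻¹ • algebraMap B T x := by
      rw [eq_inv_smul_iff₀ ha0, Algebra.smul_def, ← IsScalarTower.algebraMap_apply A K T,
        IsScalarTower.algebraMap_apply A B T, mul_comm]
      exact hx
    rw [this]
    exact Submodule.smul_mem _ _ (Submodule.subset_span ⟨x, rfl⟩)
  have good := exists_good_poly A K B T hinj
  have hfin := fun χ => ptFib_finite (R := A) (S := B) χ
  -- every fibre has at least `finrank K T` points
  have hlow : ∀ χ₀ : A →ₐ[ℂ] ℂ, Module.finrank K T ≤ Nat.card (PtFib (S := B) χ₀) := by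
    intro χ₀
    obtain ⟨c, hc⟩ := exists_primitive K T B hspan
    obtain ⟨F, hmon, h0, hdvd, hF⟩ := good c
    have hsep : (F.map (algebraMap A K)).Separable := by
      rw [hF]
      rw [PerfectField.separable_iff_squarefree]
      exact (minpoly.isRadical K _).squarefree
        (minpoly.ne_zero (Algebra.IsIntegral.isIntegral (R := K) (algebraMap B T c)))
    obtain ⟨f, hf, u, v, huv⟩ : ∃ f : A, f ≠ 0 ∧ ∃ u v : A[X], u * F + v * derivative F = C f := by
      obtain ⟨u, v, huv⟩ := hsep
      obtain ⟨a, ha, hu⟩ := IsLocalization.integerNormalization_spec A⁰ u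
      obtain ⟨a', ha', hv⟩ := IsLocalization.integerNormalization_spec A⁰ v
      refine ⟨a' * a, nonZeroDivisors.ne_zero (mul_mem ha' ha),
        C a' * IsLocalization.integerNormalization A⁰ u,
        C a * IsLocalization.integerNormalization A⁰ v, ?_⟩
      apply Polynomial.map_injective (algebraMap A K) (IsFractionRing.injective A K)
      simp only [Polynomial.map_add, Polynomial.map_mul, map_C, map_mul, hu, hv,
        ← derivative_map] at huv ⊢
      have e1 : ∀ (x : A) (w : K[X]), x • w = C (algebraMap A K x) * w := by
        intro x w
        rw [← smul_eq_C_mul, algebraMap_smul]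
      rw [e1, e1]
      linear_combination (C (algebraMap A K a') * C (algebraMap A K a)) * huv
    obtain ⟨χ, hχ, hcard⟩ := hfib χ₀ f hf
    rw [← hcard]
    have hsepχ : (F.map χ.toRingHom).Separable := by
      refine ⟨C (χ f)⁻¹ * u.map χ.toRingHom, C (χ f)⁻¹ * v.map χ.toRingHom, ?_⟩
      have := congrArg (Polynomial.map χ.toRingHom) huv
      rw [Polynomial.map_add, Polynomial.map_mul, Polynomial.map_mul, ← derivative_map, map_C]
        at this
      rw [mul_assoc, mul_assoc, ← mul_add, this, ← C_mul]
      change C ((χ f)⁻¹ * χ f) = 1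
      rw [inv_mul_cancel₀ hχ, C_1]
    have hdeg : Module.finrank K T ≤ ((F.map χ.toRingHom).roots.toFinset).card := by
      rw [Multiset.toFinset_card_of_nodup (nodup_roots hsepχ),
        ← (IsAlgClosed.splits (F.map χ.toRingHom)).natDegree_eq_card_roots, hmon.natDegree_map,
        ← hmon.natDegree_map (algebraMap A K), hF]
      exact hc
    refine hdeg.trans ?_
    have hroot : ∀ z : (F.map χ.toRingHom).roots.toFinset, ∃ ψ : PtFib (S := B) χ, ψ.1 c = z := by
      rintro ⟨z, hz⟩
      rw [Multiset.mem_toFinset, mem_roots (hmon.map _).ne_zero] at hz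
      obtain ⟨ψ, h1, h2⟩ := exists_point_root χ c F h0 hdvd z hz
      exact ⟨⟨ψ, h1⟩, h2⟩
    choose Ψ hΨ using hroot
    have hinjΨ : Function.Injective Ψ := by
      intro z z' h
      apply Subtype.ext
      rw [← hΨ, ← hΨ, h]
    have := hfin χ
    have hle := Nat.card_le_card_of_injective Ψ hinjΨ
    rwa [Nat.card_eq_fintype_card, Fintype.card_coe] at hle
  have : Algebra.FinitePresentation A B := Algebra.FinitePresentation.of_finiteType.1 inferInstance
  rw [← Algebra.etaleLocus_eq_univ_iff_etale, Set.eq_univ_iff_forall]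
  intro q
  obtain ⟨m, hm, hqm⟩ := Ideal.exists_le_maximal q.asIdeal q.2.ne_top
  obtain ⟨ψ₀, hψ₀⟩ : ∃ ψ₀ : B →ₐ[ℂ] ℂ, ∀ x ∈ q.asIdeal, ψ₀ x = 0 := by
    let : Field (B ⧸ m) := Ideal.Quotient.field m
    have : Module.Finite ℂ (B ⧸ m) := finite_of_finite_type_of_isJacobsonRing ℂ (B ⧸ m)
    let φ : (B ⧸ m) →ₐ[ℂ] ℂ := IsAlgClosed.lift
    refine ⟨φ.comp (Ideal.Quotient.mkₐ ℂ m), fun x hx => ?_⟩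
    simp [Ideal.Quotient.eq_zero_iff_mem.2 (hqm hx)]
  let χ₀ : A →ₐ[ℂ] ℂ := ψ₀.comp (IsScalarTower.toAlgHom ℂ A B)
  have := hfin χ₀
  have : Fintype (PtFib (S := B) χ₀) := Fintype.ofFinite _
  obtain ⟨b, hb⟩ := exists_separating (ι := PtFib (S := B) χ₀) (fun ψ => ψ.1.toLinearMap) (by
    intro ψ ψ' h
    exact Subtype.ext (AlgHom.toLinearMap_injective h))
  have hb' : Function.Injective (fun ψ : PtFib (S := B) χ₀ => ψ.1 b) := hb
  obtain ⟨F, hmon, h0, hdvd, hF⟩ := good b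
  have hdegle : F.natDegree ≤ Module.finrank K T := by
    rw [← hmon.natDegree_map (algebraMap A K), hF]
    exact minpoly.natDegree_le _
  set G := F.map χ₀.toRingHom with hG
  have hGm : G.Monic := hmon.map _
  have heval : ∀ (ψ : PtFib (S := B) χ₀) (H : A[X]), (H.map χ₀.toRingHom).eval (ψ.1 b) =
      ψ.1 (aeval b H) := by
    intro ψ H
    have h1 : χ₀.toRingHom = ψ.1.toRingHom.comp (algebraMap A B) := by
      ext a
      exact (ψ.2 a).symm
    rw [h1, ← Polynomial.map_map, aeval_def, ← eval_map]
    exact eval_map_apply ψ.1.toRingHom b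
  have hsub : (Finset.univ.image (fun ψ : PtFib (S := B) χ₀ => ψ.1 b)).val ≤ G.roots := by
    rw [Multiset.le_iff_subset (Finset.nodup _)]
    intro z hz
    simp only [Finset.image_val, Multiset.mem_dedup, Multiset.mem_map, Finset.mem_val,
      Finset.mem_univ, true_and] at hz
    obtain ⟨ψ, rfl⟩ := hz
    rw [mem_roots hGm.ne_zero, IsRoot, heval, h0, map_zero]
  have hcardim : (Finset.univ.image (fun ψ : PtFib (S := B) χ₀ => ψ.1 b)).val.card =
      Nat.card (PtFib (S := B) χ₀) := by
    rw [Finset.card_val, Finset.card_image_of_injective _ hb', Finset.card_univ,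
      Nat.card_eq_fintype_card]
  have hGd : G.roots.card = F.natDegree := by
    rw [← (IsAlgClosed.splits G).natDegree_eq_card_roots, hG, hmon.natDegree_map]
  have hle1 := Multiset.card_le_card hsub
  have hlow0 := hlow χ₀
  have hdeg : F.natDegree = Module.finrank K T := by omega
  have heq := Multiset.eq_of_le_of_card_le hsub (by omega)
  have hnod : G.roots.Nodup := heq ▸ Finset.nodup _
  let ψ₁ : PtFib (S := B) χ₀ := ⟨ψ₀, fun _ => rfl⟩
  have hne : ψ₀ (aeval b (derivative F)) ≠ 0 := by
    intro h
    have h1 : (derivative G).IsRoot (ψ₀ b) := by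
      rw [IsRoot, hG, derivative_map]
      exact (heval ψ₁ _).trans h
    have h2 : G.IsRoot (ψ₀ b) := by
      rw [IsRoot]
      refine (heval ψ₁ _).trans ?_
      rw [h0, map_zero]
    have h3 := (one_lt_rootMultiplicity_iff_isRoot hGm.ne_zero).2 ⟨h2, h1⟩
    rw [← count_roots] at h3
    have := Multiset.nodup_iff_count_le_one.1 hnod (ψ₀ b)
    omega
  have het := etale_away_of_conductor b F hmon h0 hdvd
    (conductor_of_degree A K B T hinj b F hmon hF hdeg)
  rw [← Algebra.basicOpen_subset_etaleLocus_iff_etale] at het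
  apply het
  intro hmem
  exact hne (hψ₀ _ hmem)

end

section
open Polynomial TensorProduct nonZeroDivisors Topology Filter

noncomputable section

open EtaleFromCover

theorem exists_small_root (F : ℂ[X]) (hF : F.Monic) (hd : F.natDegree ≠ 0) :
    ∃ z, F.eval z = 0 ∧ ‖z‖ ^ F.natDegree ≤ ‖F.eval 0‖ := by
  by_contra! h
  have hs := IsAlgClosed.splits F
  have hcard := hs.natDegree_eq_card_roots
  have hprod : ‖F.eval 0‖ = ‖F.roots.prod‖ := by
    rw [← coeff_zero_eq_eval_zero, hs.coeff_zero_eq_prod_roots_of_monic hF]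
    simp
  have key : ∀ (s : Multiset ℂ) (c : ℝ) (n : ℕ), 0 ≤ c → (∀ z ∈ s, c < ‖z‖ ^ n) → s ≠ 0 →
      c ^ s.card < ‖s.prod‖ ^ n := by
    intro s c n hc
    induction s using Multiset.induction_on with
    | empty => simp
    | cons a s ih =>
      intro hs _
      have ha := hs a (Multiset.mem_cons_self _ _)
      by_cases h0 : s = 0
      · subst h0; simpa using ha
      · have := ih (fun z hz => hs z (Multiset.mem_cons_of_mem hz)) h0
        rw [Multiset.card_cons, Multiset.prod_cons, norm_mul, mul_pow, pow_succ, mul_comm]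
        exact mul_lt_mul'' ha this hc (by positivity)
  have := key F.roots ‖F.eval 0‖ F.natDegree (norm_nonneg _)
    (fun z hz => h z ((mem_roots hF.ne_zero).1 hz)) (by
      intro h0
      rw [h0] at hcard
      exact hd (by simpa using hcard))
  rw [← hcard, hprod] at this
  exact lt_irrefl _ this

/-- evaluation at a point -/
def evPt {N : ℕ} (J : Ideal (MvPolynomial (Fin N) ℂ)) (v : points J) :
    (MvPolynomial (Fin N) ℂ ⧸ J) →ₐ[ℂ] ℂ :=
  Ideal.Quotient.liftₐ J (MvPolynomial.aeval (v : Fin N → ℂ)) v.2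

theorem evPt_mk {N : ℕ} (J : Ideal (MvPolynomial (Fin N) ℂ)) (v : points J)
    (Q : MvPolynomial (Fin N) ℂ) : evPt J v (Ideal.Quotient.mk J Q) =
      MvPolynomial.aeval (v : Fin N → ℂ) Q := rfl

theorem evPt_bijective {N : ℕ} (J : Ideal (MvPolynomial (Fin N) ℂ)) :
    Function.Bijective (evPt J) := by
  constructor
  · intro v w h
    apply Subtype.ext
    funext i
    have := DFunLike.congr_fun h (Ideal.Quotient.mk J (MvPolynomial.X i))
    simpa [evPt_mk] using this
  · intro χ
    have h : ∀ Q, MvPolynomial.aeval (fun i => χ (Ideal.Quotient.mk J (MvPolynomial.X i))) Q =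
        χ (Ideal.Quotient.mk J Q) := by
      intro Q
      have : MvPolynomial.aeval (fun i => χ (Ideal.Quotient.mk J (MvPolynomial.X i))) =
        χ.comp (Ideal.Quotient.mkₐ ℂ J) := by
        ext i; simp
      rw [this]; rfl
    refine ⟨⟨fun i => χ (Ideal.Quotient.mk J (MvPolynomial.X i)), fun Q hQ => ?_⟩, ?_⟩
    · rw [h, Ideal.Quotient.eq_zero_iff_mem.2 hQ, map_zero]
    · ext x
      obtain ⟨Q, rfl⟩ := Ideal.Quotient.mk_surjective x
      rw [evPt_mk, h]

theorem evPt_continuous {N : ℕ} (J : Ideal (MvPolynomial (Fin N) ℂ))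
    (a : MvPolynomial (Fin N) ℂ ⧸ J) : Continuous (fun v => evPt J v a) := by
  obtain ⟨Q, rfl⟩ := Ideal.Quotient.mk_surjective a
  simp only [evPt_mk, MvPolynomial.aeval_eq_eval]
  exact (MvPolynomial.continuous_eval Q).comp continuous_subtype_val

theorem isClosed_points {N : ℕ} (J : Ideal (MvPolynomial (Fin N) ℂ)) : IsClosed (points J) := by
  have : points J = ⋂ Q ∈ J, {v | MvPolynomial.aeval v Q = 0} := by
    ext v; simp [points]
  rw [this]
  refine isClosed_biInter fun Q _ => isClosed_eq ?_ continuous_const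
  simp only [MvPolynomial.aeval_eq_eval]
  exact MvPolynomial.continuous_eval Q

theorem frequently_ne_zero {m : ℕ} (h : MvPolynomial (Fin m) ℂ) (hh : h ≠ 0) (t₀ : Fin m → ℂ) :
    ∃ᶠ t in 𝓝 t₀, MvPolynomial.eval t h ≠ 0 := by
  obtain ⟨e, he⟩ : ∃ e, MvPolynomial.eval e h ≠ 0 := by
    by_contra! hc
    exact hh (MvPolynomial.funext (fun x => by simp [hc x]))
  obtain ⟨q, hqdef⟩ : ∃ q : ℂ[X],
    q = MvPolynomial.aeval (fun i => C (t₀ i) + X * C (e i - t₀ i)) h := ⟨_, rfl⟩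
  have hq : ∀ s, q.eval s = MvPolynomial.eval (fun i => t₀ i + s * (e i - t₀ i)) h := by
    intro s
    have h1 : (aeval s : ℂ[X] →ₐ[ℂ] ℂ) (MvPolynomial.aeval
        (fun i => C (t₀ i) + X * C (e i - t₀ i)) h) =
        MvPolynomial.aeval (fun i => t₀ i + s * (e i - t₀ i)) h := by
      rw [MvPolynomial.comp_aeval_apply]
      congr 2
      funext i
      simp
    rw [← hqdef, coe_aeval_eq_eval, MvPolynomial.aeval_eq_eval] at h1
    exact h1
  have hq0 : q ≠ 0 := by
    intro h0
    have := hq 1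
    rw [h0] at this
    simp at this
    exact he this.symm
  have h1 : ∀ᶠ s in 𝓝[≠] (0 : ℂ), q.eval s ≠ 0 := by
    have hfin : Set.Finite {s | q.eval s = 0} := by
      refine (q.roots.toFinset.finite_toSet).subset fun s hs => ?_
      simpa [hq0] using hs
    have := (hfin.subset (Set.sdiff_subset (t := {0}))).isClosed.isOpen_compl.mem_nhds
      (x := (0 : ℂ)) (by simp)
    filter_upwards [mem_nhdsWithin_of_mem_nhds this, self_mem_nhdsWithin] with s hs hs0 hs1
    exact hs ⟨hs1, hs0⟩
  have h2 : Tendsto (fun s : ℂ => fun i => t₀ i + s * (e i - t₀ i)) (𝓝[≠] 0) (𝓝 t₀) := by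
    have : Continuous (fun s : ℂ => fun i => t₀ i + s * (e i - t₀ i)) := by fun_prop
    have := (this.tendsto 0).mono_left (nhdsWithin_le_nhds (s := {0}ᶜ))
    simpa using this
  apply h2.frequently
  apply Eventually.frequently
  filter_upwards [h1] with s hs
  rwa [← hq]

end

end

section
open Polynomial TensorProduct nonZeroDivisors Topology Filter
open EtaleFromCover

theorem roots_locally_bounded {m : ℕ} (G : (MvPolynomial (Fin m) ℂ)[X]) (hG : G.Monic)
    (t₀ : Fin m → ℂ) : ∃ R : ℝ, ∀ᶠ t in 𝓝 t₀, ∀ z : ℂ,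
      (G.map (MvPolynomial.eval t)).eval z = 0 → ‖z‖ ≤ R := by
  have hc : Continuous (fun t : Fin m → ℂ =>
      ∑ i ∈ Finset.range G.natDegree, ‖MvPolynomial.eval t (G.coeff i)‖) :=
    continuous_finsetSum _ fun i _ => (MvPolynomial.continuous_eval _).norm
  obtain ⟨S, hS⟩ : ∃ S : (Fin m → ℂ) → ℝ, S = fun t : Fin m → ℂ =>
      ∑ i ∈ Finset.range G.natDegree, ‖MvPolynomial.eval t (G.coeff i)‖ := ⟨_, rfl⟩
  rw [← hS] at hc
  refine ⟨S t₀ + 1 + 1, ?_⟩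
  filter_upwards [(hc.tendsto t₀).eventually_lt_const (lt_add_one (S t₀))] with t ht z hz
  have hm := hG.map (MvPolynomial.eval t)
  have h1 := IsRoot.norm_lt_cauchyBound hm.ne_zero hz
  have h2 : (cauchyBound (G.map (MvPolynomial.eval t)) : ℝ) ≤ S t + 1 := by
    have : cauchyBound (G.map (MvPolynomial.eval t)) ≤
      (∑ i ∈ Finset.range G.natDegree, ‖MvPolynomial.eval t (G.coeff i)‖₊) + 1 := by
      rw [cauchyBound, hm.leadingCoeff]
      simp only [nnnorm_one, div_one]
      gcongr
      rw [hG.natDegree_map]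
      refine Finset.sup_le fun i hi => ?_
      rw [coeff_map]
      exact Finset.single_le_sum (f := fun i => ‖MvPolynomial.eval t (G.coeff i)‖₊)
        (fun _ _ => zero_le) hi
    rw [hS]
    have := NNReal.coe_le_coe.2 this
    simpa using this
  have h3 : ‖z‖ < (cauchyBound (G.map (MvPolynomial.eval t)) : ℝ) := by exact_mod_cast h1
  linarith

theorem dense_ne_zero {N : ℕ} (J : Ideal (MvPolynomial (Fin N) ℂ))
    [IsDomain (MvPolynomial (Fin N) ℂ ⧸ J)] (f : MvPolynomial (Fin N) ℂ ⧸ J) (hf : f ≠ 0)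
    (v₀ : points J) (U : Set (points J)) (hU : U ∈ 𝓝 v₀) : ∃ v ∈ U, evPt J v f ≠ 0 := by
  obtain ⟨m, g, hginj, hgfin⟩ := exists_finite_inj_algHom_of_fg ℂ (MvPolynomial (Fin N) ℂ ⧸ J)
  let A := MvPolynomial (Fin N) ℂ ⧸ J
  let P := MvPolynomial (Fin m) ℂ
  let : Algebra P A := g.toRingHom.toAlgebra
  have halg : ∀ x : P, algebraMap P A x = g x := fun x => rfl
  have : IsScalarTower ℂ P A := IsScalarTower.of_algebraMap_eq (fun z => (g.commutes z).symm)
  let : Module P A := Algebra.toModule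
  have : Module.Finite P A := hgfin
  have : Algebra.IsIntegral P A := inferInstance
  have : FaithfulSMul P A := (faithfulSMul_iff_algebraMap_injective P A).2 hginj
  let θ : points J → (Fin m → ℂ) := fun v i => evPt J v (g (MvPolynomial.X i))
  have hθ : ∀ v (x : P), evPt J v (g x) = MvPolynomial.eval (θ v) x := by
    intro v x
    have : (evPt J v).comp g = MvPolynomial.aeval (θ v) := by
      ext i; simp [θ]
    rw [← MvPolynomial.aeval_eq_eval, ← this]; rfl
  have hθc : Continuous θ := continuous_pi fun i => evPt_continuous J _
  let t₀ := θ v₀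
  obtain ⟨h, hh, hdvd⟩ := ((Algebra.IsIntegral.isIntegral (R := P) f).isAlgebraic).exists_nonzero_dvd
    (mem_nonZeroDivisors_of_ne_zero hf)
  have hfin : Finite (PtFib (S := A) (MvPolynomial.aeval t₀ : P →ₐ[ℂ] ℂ)) := ptFib_finite _
  obtain ⟨b₀, hb₀⟩ := exists_separating (k := ℂ) (E := A) (M := ℂ)
    (fun ψ : PtFib (S := A) (MvPolynomial.aeval t₀ : P →ₐ[ℂ] ℂ) => ψ.1.toLinearMap)
    (fun ψ ψ' hψ => Subtype.ext (AlgHom.toLinearMap_injective hψ))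
  let b : A := b₀ - algebraMap ℂ A (evPt J v₀ b₀)
  have hb : ∀ v, evPt J v b = evPt J v b₀ - evPt J v₀ b₀ := by
    intro v; simp [b, A]
  have hsep : ∀ v, θ v = t₀ → evPt J v b = 0 → v = v₀ := by
    intro v hv hbv
    apply (evPt_bijective J).1
    have e : ∀ v, θ v = t₀ → ∀ r : P, evPt J v (algebraMap P A r) =
        (MvPolynomial.aeval t₀ : P →ₐ[ℂ] ℂ) r := by
      intro v hv r
      rw [halg, hθ, hv, MvPolynomial.aeval_eq_eval]
    have := @hb₀ ⟨evPt J v, e v hv⟩ ⟨evPt J v₀, e v₀ rfl⟩ (by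
      rw [hb, sub_eq_zero] at hbv
      exact hbv)
    exact congrArg Subtype.val this
  have hbint : IsIntegral P b := Algebra.IsIntegral.isIntegral b
  let F : P[X] := minpoly P b
  have hFm : F.Monic := minpoly.monic hbint
  have hFdeg : F.natDegree ≠ 0 := (minpoly.natDegree_pos hbint).ne'
  have hroot : ∀ (G : P[X]) (a : A) v, aeval a G = 0 →
      (G.map (MvPolynomial.eval (θ v))).eval (evPt J v a) = 0 := by
    intro G a v hG
    have h1 : (evPt J v).toRingHom.comp (algebraMap P A) = MvPolynomial.eval (θ v) := by
      ext x
      · simp [halg]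
      · simp [halg, hθ]
    rw [← h1, eval_map]
    have := congrArg (evPt J v).toRingHom hG
    rw [aeval_def, hom_eval₂, map_zero] at this
    exact this
  have hF0 : MvPolynomial.eval t₀ (F.coeff 0) = 0 := by
    have h1 := hroot F b v₀ (minpoly.aeval _ _)
    have h2 : evPt J v₀ b = 0 := by rw [hb, sub_self]
    rw [h2, ← coeff_zero_eq_eval_zero, coeff_map] at h1
    exact h1
  have hex : ∀ t : Fin m → ℂ, ∃ v : points J, θ v = t ∧
      ‖evPt J v b‖ ^ F.natDegree ≤ ‖MvPolynomial.eval t (F.coeff 0)‖ := by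
    intro t
    obtain ⟨z, hz, hzn⟩ := exists_small_root (F.map (MvPolynomial.eval t)) (hFm.map _)
      (by rwa [hFm.natDegree_map])
    rw [hFm.natDegree_map, ← coeff_zero_eq_eval_zero, coeff_map] at hzn
    have hχ : (MvPolynomial.aeval t : P →ₐ[ℂ] ℂ).toRingHom = MvPolynomial.eval t := by
      ext <;> simp
    obtain ⟨ψ, hψ, hψb⟩ := exists_point_root (S := A) (MvPolynomial.aeval t : P →ₐ[ℂ] ℂ) b F
      (minpoly.aeval _ _) (fun G hG => minpoly.isIntegrallyClosed_dvd hbint hG) z (by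
        rw [hχ]; exact hz)
    obtain ⟨v, rfl⟩ := (evPt_bijective J).2 ψ
    refine ⟨v, ?_, ?_⟩
    · funext i
      have := hψ (MvPolynomial.X i)
      rw [MvPolynomial.aeval_X] at this
      exact this
    · rw [hψb]; exact hzn
  choose v hvθ hvb using hex
  -- bounded coordinates
  have hbd : ∀ i : Fin N, ∃ R : ℝ, ∀ᶠ t in 𝓝 t₀, ‖(v t : Fin N → ℂ) i‖ ≤ R := by
    intro i
    let a : A := Ideal.Quotient.mk J (MvPolynomial.X i)
    obtain ⟨G, hG, hG0⟩ := Algebra.IsIntegral.isIntegral (R := P) a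
    obtain ⟨R, hR⟩ := roots_locally_bounded G hG t₀
    refine ⟨R, ?_⟩
    filter_upwards [hR] with t ht
    have := hroot G a (v t) hG0
    rw [hvθ] at this
    have := ht _ this
    rw [show evPt J (v t) a = (v t : Fin N → ℂ) i by simp [a, evPt_mk]] at this
    exact this
  choose R hR using hbd
  have hcpt : IsCompact {w : points J | ∀ i, ‖(w : Fin N → ℂ) i‖ ≤ R i} := by
    have h1 : IsCompact (Set.univ.pi fun i => Metric.closedBall (0 : ℂ) (R i)) :=
      isCompact_univ_pi fun i => isCompact_closedBall _ _
    have h2 := (isClosed_points J).isClosedEmbedding_subtypeVal.isCompact_preimage h1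
    convert h2 using 1
    ext w
    simp
  have htend : Tendsto v (𝓝 t₀) (𝓝 v₀) := by
    refine hcpt.tendsto_nhds_of_unique_mapClusterPt ?_ ?_
    · rw [← eventually_all] at hR
      exact hR
    · intro w _ hw
      apply hsep
      · have h1 : MapClusterPt (θ w) (𝓝 t₀) (θ ∘ v) := hw.continuousAt_comp hθc.continuousAt
        have h2 : θ ∘ v = id := funext hvθ
        rw [h2] at h1
        have : ClusterPt (θ w) (𝓝 t₀) := by simpa [MapClusterPt] using h1
        exact eq_of_nhds_neBot this
      · have h1 := hw.continuousAt_comp (evPt_continuous J b).continuousAt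
        have h2 : Tendsto ((fun v => evPt J v b) ∘ v) (𝓝 t₀) (𝓝 0) := by
          rw [tendsto_zero_iff_norm_tendsto_zero]
          have h3 : Tendsto (fun t => ‖MvPolynomial.eval t (F.coeff 0)‖) (𝓝 t₀) (𝓝 0) := by
            have := ((MvPolynomial.continuous_eval (F.coeff 0)).norm).tendsto t₀
            rwa [hF0, norm_zero] at this
          have h4 : Tendsto (fun t => ‖evPt J (v t) b‖ ^ F.natDegree) (𝓝 t₀) (𝓝 0) :=
            squeeze_zero (fun t => by positivity) hvb h3
          have h5 := h4.rpow_const (p := ((F.natDegree : ℝ)⁻¹)) (Or.inr (by positivity))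
          rw [Real.zero_rpow (by positivity)] at h5
          refine h5.congr fun t => ?_
          exact Real.pow_rpow_inv_natCast (norm_nonneg _) hFdeg
        have h3 : ClusterPt (evPt J w b) (𝓝 0) := h1.clusterPt.mono h2
        exact eq_of_nhds_neBot h3
  obtain ⟨t, ht, htU⟩ := ((frequently_ne_zero h hh t₀).and_eventually (htend.eventually hU)).exists
  refine ⟨v t, htU, fun h0 => ht ?_⟩
  obtain ⟨c, hc⟩ := hdvd
  have := hθ (v t) h
  rw [hvθ] at this
  rw [← this, ← halg, hc, map_mul, h0, zero_mul]

end

section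
open Polynomial TensorProduct nonZeroDivisors Topology Filter
open EtaleFromCover

theorem evPt_induced {r s : ℕ}
    (I : Ideal (MvPolynomial (Fin s) ℂ)) (J : Ideal (MvPolynomial (Fin r) ℂ))
    (p : Fin r → MvPolynomial (Fin s) ℂ)
    (hmap : ∀ Q ∈ J, MvPolynomial.aeval p Q ∈ I) (w : points I)
    (a : MvPolynomial (Fin r) ℂ ⧸ J) :
    evPt I w (inducedRingHom I J p hmap a) = evPt J (pointsMap I J p hmap w) a := by
  obtain ⟨Q, rfl⟩ := Ideal.Quotient.mk_surjective a
  rw [evPt_mk]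
  show MvPolynomial.aeval (w : Fin s → ℂ) (MvPolynomial.aeval p Q) = _
  rw [MvPolynomial.comp_aeval_apply]
  rfl

theorem exists_evPt_ne_zero {s : ℕ} (I : Ideal (MvPolynomial (Fin s) ℂ)) (hI : I.IsRadical)
    (b : MvPolynomial (Fin s) ℂ ⧸ I) (hb : b ≠ 0) : ∃ w, evPt I w b ≠ 0 := by
  by_contra! h
  obtain ⟨Q, rfl⟩ := Ideal.Quotient.mk_surjective b
  apply hb
  rw [Ideal.Quotient.eq_zero_iff_mem, ← hI.radical,
    ← MvPolynomial.vanishingIdeal_zeroLocus_eq_radical (k := ℂ) (K := ℂ),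
    MvPolynomial.mem_vanishingIdeal_iff]
  intro x hx
  exact h ⟨x, hx⟩

theorem card_fiber_eq {X E : Type*} [TopologicalSpace X] [TopologicalSpace E] (π : E → X)
    (hπ : IsCoveringMap π) (x₀ : X) : ∃ U ∈ 𝓝 x₀, ∀ x ∈ U,
      Nat.card (π ⁻¹' {x}) = Nat.card (π ⁻¹' {x₀}) := by
  obtain ⟨hd, U, hxU, hU, hfU, H, hH⟩ := hπ x₀
  refine ⟨U, hU.mem_nhds hxU, fun x hx => ?_⟩
  have : IsEvenlyCovered π x (π ⁻¹' {x₀}) := ⟨hd, U, hx, hU, hfU, H, hH⟩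
  exact (Nat.card_congr this.fiberHomeomorph.toEquiv).symm

theorem main_aux {r s : ℕ}
    (I : Ideal (MvPolynomial (Fin s) ℂ)) (J : Ideal (MvPolynomial (Fin r) ℂ))
    (hIrad : I.IsRadical)
    (p : Fin r → MvPolynomial (Fin s) ℂ)
    (hmap : ∀ Q ∈ J, MvPolynomial.aeval p Q ∈ I)
    (hdomain : IsDomain (MvPolynomial (Fin r) ℂ ⧸ J))
    (hnormal : IsIntegrallyClosed (MvPolynomial (Fin r) ℂ ⧸ J))
    [Algebra (MvPolynomial (Fin r) ℂ ⧸ J) (MvPolynomial (Fin s) ℂ ⧸ I)]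
    (halg : ∀ a, algebraMap (MvPolynomial (Fin r) ℂ ⧸ J) (MvPolynomial (Fin s) ℂ ⧸ I) a =
      inducedRingHom I J p hmap a)
    (hfin : Module.Finite (MvPolynomial (Fin r) ℂ ⧸ J) (MvPolynomial (Fin s) ℂ ⧸ I))
    (hcov : IsCoveringMap (pointsMap I J p hmap)) :
    Algebra.Etale (MvPolynomial (Fin r) ℂ ⧸ J) (MvPolynomial (Fin s) ℂ ⧸ I) := by
  have : IsScalarTower ℂ (MvPolynomial (Fin r) ℂ ⧸ J) (MvPolynomial (Fin s) ℂ ⧸ I) :=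
    IsScalarTower.of_algebraMap_eq (R := ℂ) (S := MvPolynomial (Fin r) ℂ ⧸ J)
      (A := MvPolynomial (Fin s) ℂ ⧸ I) (fun z => by
      rw [halg]
      show Ideal.Quotient.mk I (MvPolynomial.C z) =
        Ideal.Quotient.mk I (MvPolynomial.aeval p (MvPolynomial.C z))
      simp [MvPolynomial.algebraMap_eq])
  have : IsReduced (MvPolynomial (Fin s) ℂ ⧸ I) :=
    (Ideal.isRadical_iff_quotient_reduced I).1 hIrad
  have hcard : ∀ v, Nat.card (PtFib (S := MvPolynomial (Fin s) ℂ ⧸ I) (evPt J v)) =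
      Nat.card (pointsMap I J p hmap ⁻¹' {v}) := by
    intro v
    symm
    refine Nat.card_congr (Equiv.ofBijective
      (fun w => ⟨evPt I w.1, fun a => ?_⟩) ⟨?_, ?_⟩)
    · rw [halg, evPt_induced, w.2]
    · intro w w' h
      exact Subtype.ext ((evPt_bijective I).1 (congrArg Subtype.val h))
    · rintro ⟨ψ, hψ⟩
      obtain ⟨w, rfl⟩ := (evPt_bijective I).2 ψ
      refine ⟨⟨w, ?_⟩, rfl⟩
      apply (evPt_bijective J).1
      ext1 a
      rw [← hψ, halg, evPt_induced]
  apply core_etale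
  · intro f τ hf h0
    by_contra hτ
    obtain ⟨w, hw⟩ := exists_evPt_ne_zero I hIrad τ hτ
    have hN : {w | evPt I w τ ≠ 0} ∈ 𝓝 w :=
      (isOpen_ne_fun (evPt_continuous I τ) continuous_const).mem_nhds hw
    have hN' := hcov.isOpenMap.image_mem_nhds hN
    obtain ⟨v, ⟨w', hw', rfl⟩, hv⟩ := dense_ne_zero J f hf _ _ hN'
    have := congrArg (evPt I w') h0
    rw [map_mul, halg, evPt_induced, map_zero] at this
    exact (mul_ne_zero hv hw') this
  · intro χ₀ f hf
    obtain ⟨v₀, rfl⟩ := (evPt_bijective J).2 χ₀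
    obtain ⟨U, hU, hUc⟩ := card_fiber_eq _ hcov v₀
    obtain ⟨v, hv, hvf⟩ := dense_ne_zero J f hf v₀ U hU
    exact ⟨evPt J v, hvf, by rw [hcard, hcard, hUc v hv]⟩

end

noncomputable section
namespace EtaleFromCover

open MvPolynomial

/-- let `π : W → V` be a finite dominant morphism of complex
(quasi-projective, here affine as explained above) varieties with `V` normal (its
coordinate ring `A` is an integrally closed domain).  If the induced map
`π : W(ℂ) → V(ℂ)` on complex points with the Euclidean topology is a topological cover
(a surjective covering map), then `π` is étale, i.e. `B` is an étale `A`-algebra. -/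
theorem etale_of_isCoveringMap_of_normal_base {r s : ℕ}
    (I : Ideal (MvPolynomial (Fin s) ℂ)) (J : Ideal (MvPolynomial (Fin r) ℂ))
    (hIrad : I.IsRadical) (hJrad : J.IsRadical)
    (p : Fin r → MvPolynomial (Fin s) ℂ)
    (hmap : ∀ Q ∈ J, MvPolynomial.aeval p Q ∈ I)
    (hdomain : IsDomain (MvPolynomial (Fin r) ℂ ⧸ J))
    (hnormal : IsIntegrallyClosed (MvPolynomial (Fin r) ℂ ⧸ J))
    (hdominant : Function.Injective (inducedRingHom I J p hmap)) :
    letI : Algebra (MvPolynomial (Fin r) ℂ ⧸ J) (MvPolynomial (Fin s) ℂ ⧸ I) :=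
      (inducedRingHom I J p hmap).toAlgebra
    Module.Finite (MvPolynomial (Fin r) ℂ ⧸ J) (MvPolynomial (Fin s) ℂ ⧸ I) →
    Function.Surjective (pointsMap I J p hmap) →
    IsCoveringMap (pointsMap I J p hmap) →
    Algebra.Etale (MvPolynomial (Fin r) ℂ ⧸ J) (MvPolynomial (Fin s) ℂ ⧸ I) := by
  let : Algebra (MvPolynomial (Fin r) ℂ ⧸ J) (MvPolynomial (Fin s) ℂ ⧸ I) :=
    (inducedRingHom I J p hmap).toAlgebra
  intro hfin _ hcov
  exact main_aux I J hIrad p hmap hdomain hnormal (fun _ => rfl) hfin hcov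


end EtaleFromCover
end
end
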